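/- arXiv:2408.04185 — 2 statements merged into one kernel-verified Lean document; each statement's English description precedes it below -/
import Mathlib

section
/- Let n and r be integers with 1 ≤ r < n. Let Y_{n,r} be the set of pairs (π, c) with π ∈ S_{n-1} and c an integer satisfying |Excp_r(π)| < c ≤ exc_r(π) + r - 1. Then there exists an injection β from Y_{n,r} into S_{n,r} ∖ S*_{n,r} such that for every (π,c) ∈ Y_{n,r}: exc_r(β(π,c)) = exc_r(π) and den_r(β(π,c)) = den_r(π) + c. -/
open Finset

/-- The value of the permutation `π ∈ S_n` at the (1-based) position `i`,
in one-line notation with letters `1,…,n`; `0` if `i` is out of range. -/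
def pval {n : ℕ} (π : Equiv.Perm (Fin n)) (i : ℕ) : ℕ :=
  if h : 1 ≤ i ∧ i ≤ n then ((π ⟨i - 1, by omega⟩ : Fin n) : ℕ) + 1 else 0

/-- The number of inversions of a word `w`, i.e. pairs of positions `i < j`
with `w_i > w_j`. -/
def winv (w : List ℕ) : ℕ :=
  ((Finset.range w.length ×ˢ Finset.range w.length).filter
    (fun p => p.1 < p.2 ∧ w.getD p.2 0 < w.getD p.1 0)).card

/-- `rDes(π) = {i ∈ [n-1] : π_i ≥ π_{i+1} + r}`. -/
def rDesSet {n : ℕ} (r : ℕ) (π : Equiv.Perm (Fin n)) : Finset ℕ :=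
  (Finset.Icc 1 (n - 1)).filter (fun i => pval π (i + 1) + r ≤ pval π i)

/-- The `r`-descent number `rdes(π)`. -/
def rdes {n : ℕ} (r : ℕ) (π : Equiv.Perm (Fin n)) : ℕ := (rDesSet r π).card

/-- `rInv(π) = {(i,j) : i < j, π_i > π_j, π_i < π_j + r}`. -/
def rInvSet {n : ℕ} (r : ℕ) (π : Equiv.Perm (Fin n)) : Finset (ℕ × ℕ) :=
  ((Finset.Icc 1 n) ×ˢ (Finset.Icc 1 n)).filter
    (fun p => p.1 < p.2 ∧ pval π p.2 < pval π p.1 ∧ pval π p.1 < pval π p.2 + r)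

/-- The `r`-major index `rmaj(π) = ∑_{i ∈ rDes(π)} i + |rInv(π)|`. -/
def rmaj {n : ℕ} (r : ℕ) (π : Equiv.Perm (Fin n)) : ℕ :=
  (∑ i ∈ rDesSet r π, i) + (rInvSet r π).card

/-- The inversion number `inv(π)`: the number of pairs `i < j` with `π_i > π_j`. -/
def invStat {n : ℕ} (π : Equiv.Perm (Fin n)) : ℕ :=
  (((Finset.Icc 1 n) ×ˢ (Finset.Icc 1 n)).filter
    (fun p => p.1 < p.2 ∧ pval π p.2 < pval π p.1)).card

/-- `Excp_r(π)`: the set of `r`-level excedance places, i.e. indices `i`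
with `π_i > i` and `π_i ≥ r`. -/
def excpSet {n : ℕ} (r : ℕ) (π : Equiv.Perm (Fin n)) : Finset ℕ :=
  (Finset.Icc 1 n).filter (fun i => i < pval π i ∧ r ≤ pval π i)

/-- `Exc_r(π)`: the subword of `π` on the `r`-level excedance places,
in increasing order of position. -/
def excWord {n : ℕ} (r : ℕ) (π : Equiv.Perm (Fin n)) : List ℕ :=
  ((excpSet r π).sort (· ≤ ·)).map (pval π)

/-- `Nexc_r(π)`: the subword of `π` on the non-`r`-level-excedance places,
in increasing order of position. -/
def nexcWord {n : ℕ} (r : ℕ) (π : Equiv.Perm (Fin n)) : List ℕ :=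
  (((Finset.Icc 1 n) \ excpSet r π).sort (· ≤ ·)).map (pval π)

/-- The `r`-level Denert statistic
`den_r(π) = ∑_{i ∈ Excp_r(π)} i + inv(Exc_r(π)) + inv(Nexc_r(π))`. -/
def denr {n : ℕ} (r : ℕ) (π : Equiv.Perm (Fin n)) : ℕ :=
  (∑ i ∈ excpSet r π, i) + winv (excWord r π) + winv (nexcWord r π)

/-- The `r`-level excedance number `exc_r(π) = |{i : π_i > i ≥ r}|`. -/
def excr {n : ℕ} (r : ℕ) (π : Equiv.Perm (Fin n)) : ℕ :=
  ((Finset.Icc 1 n).filter (fun i => r ≤ i ∧ i < pval π i)).card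

/-- `i` is a grande-fixed place of `τ`: either `τ_i = i`, or `τ_i > i` and
there is no index `j` with `τ_j > j` and `i ≤ τ_j < τ_i`. -/
def grandeFixedPlace {n : ℕ} (τ : Equiv.Perm (Fin n)) (i : ℕ) : Prop :=
  1 ≤ i ∧ i ≤ n ∧
    (pval τ i = i ∨
      (i < pval τ i ∧ ∀ j, 1 ≤ j → j ≤ n → j < pval τ j →
        ¬ (i ≤ pval τ j ∧ pval τ j < pval τ i)))

/-- `S_{n,r}`: the set of permutations in `S_n` with no `r`-level grande-fixed
place (a grande-fixed place `i` with `i ≥ r`). -/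
def Snr (n r : ℕ) : Set (Equiv.Perm (Fin n)) :=
  {τ | ¬ ∃ i, r ≤ i ∧ grandeFixedPlace τ i}

/-- `S*_{n,r} = {τ ∈ S_{n,r} : τ_r > r}`. -/
def SnrStar (n r : ℕ) : Set (Equiv.Perm (Fin n)) :=
  {τ ∈ Snr n r | r < pval τ r}

/-- `Y_{n,r}`: pairs (π, c) with π ∈ S_{n-1} and
|Excp_r(π)| < c ≤ exc_r(π) + r - 1. -/
def Ynr (n r : ℕ) : Set (Equiv.Perm (Fin (n - 1)) × ℕ) :=
  {p | (excpSet r p.1).card < p.2 ∧ p.2 ≤ excr r p.1 + r - 1}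

/-- The number of elements of `S` below `x`. -/
def finRank (S : Finset ℕ) (x : ℕ) : ℕ := (S.filter (· < x)).card

/-- The element of `S` with exactly `k` elements of `S` below it. -/
noncomputable def finSel (S : Finset ℕ) (k : ℕ) : ℕ := Nat.nth (· ∈ S) k

theorem finRank_eq_count (S : Finset ℕ) (x : ℕ) : finRank S x = Nat.count (· ∈ S) x := by
  rw [Nat.count_eq_card_filter_range, finRank]
  congr 1
  ext y
  simp [and_comm]

theorem finSel_mem {S : Finset ℕ} {k : ℕ} (hk : k < S.card) : finSel S k ∈ S :=
  Nat.nth_mem (p := (· ∈ S)) k fun hf => by simpa using hk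

theorem finRank_finSel {S : Finset ℕ} {k : ℕ} (hk : k < S.card) :
    finRank S (finSel S k) = k := by
  rw [finRank_eq_count]
  exact Nat.count_nth (p := (· ∈ S)) fun hf => by simpa using hk

theorem finSel_finRank {S : Finset ℕ} {x : ℕ} (hx : x ∈ S) : finSel S (finRank S x) = x := by
  rw [finRank_eq_count]
  exact Nat.nth_count (p := (· ∈ S)) hx

theorem finRank_lt_finRank {S : Finset ℕ} {x y : ℕ} (hx : x ∈ S) (hxy : x < y) :
    finRank S x < finRank S y := by
  rw [finRank_eq_count, finRank_eq_count]
  exact Nat.count_strict_mono (p := (· ∈ S)) hx hxy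

theorem finRank_lt_card {S : Finset ℕ} {x : ℕ} (hx : x ∈ S) : finRank S x < S.card :=
  card_lt_card ⟨filter_subset _ _, fun h => by simpa using h hx⟩

theorem finSel_lt_finSel {S : Finset ℕ} {k l : ℕ} (hkl : k < l) (hl : l < S.card) :
    finSel S k < finSel S l := by
  by_contra! h
  rcases h.eq_or_lt with h | h
  · have := congrArg (finRank S) h
    rw [finRank_finSel hl, finRank_finSel (hkl.trans hl)] at this
    omega
  · have := finRank_lt_finRank (finSel_mem hl) h
    rw [finRank_finSel hl, finRank_finSel (hkl.trans hl)] at this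
    omega

/-- The increasing map from `S` to `T`, for finite sets of the same size. -/
noncomputable def ordMap (S T : Finset ℕ) (x : ℕ) : ℕ := finSel T (finRank S x)

theorem ordMap_mem {S T : Finset ℕ} (h : S.card = T.card) {x : ℕ} (hx : x ∈ S) :
    ordMap S T x ∈ T :=
  finSel_mem (h ▸ finRank_lt_card hx)

theorem ordMap_lt {S T : Finset ℕ} (h : S.card = T.card) {x y : ℕ} (hx : x ∈ S) (hy : y ∈ S)
    (hxy : x < y) : ordMap S T x < ordMap S T y :=
  finSel_lt_finSel (finRank_lt_finRank hx hxy) (h ▸ finRank_lt_card hy)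

theorem ordMap_inj {S T : Finset ℕ} (h : S.card = T.card) {x y : ℕ} (hx : x ∈ S) (hy : y ∈ S)
    (hxy : ordMap S T x = ordMap S T y) : x = y := by
  rcases lt_trichotomy x y with hl | hl | hl
  · exact absurd hxy (ordMap_lt h hx hy hl).ne
  · exact hl
  · exact absurd hxy.symm (ordMap_lt h hy hx hl).ne

/-- The number of inversions of `f` on the positions in `S`. -/
def invOn (S : Finset ℕ) (f : ℕ → ℕ) : ℕ :=
  ((S ×ˢ S).filter fun p => p.1 < p.2 ∧ f p.2 < f p.1).card

theorem winv_map_sort (S : Finset ℕ) (f : ℕ → ℕ) :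
    winv ((S.sort (· ≤ ·)).map f) = invOn S f := by
  have hg : ∀ k, k < S.card → ((S.sort (· ≤ ·)).map f).getD k 0 =
      f ((S.sort (· ≤ ·)).getD k 0) := by
    intro k hk
    simp [List.getD_eq_getElem?_getD, hk]
  have hs : ∀ k, k < S.card → (S.sort (· ≤ ·)).getD k 0 ∈ S := by
    intro k hk
    have h : k < (S.sort (· ≤ ·)).length := by simpa using hk
    rw [List.getD_eq_getElem _ _ h]
    exact (S.mem_sort (· ≤ ·)).1 (List.getElem_mem h)
  have hlt : ∀ k l, l < S.card → k < l →
      (S.sort (· ≤ ·)).getD k 0 < (S.sort (· ≤ ·)).getD l 0 := by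
    intro k l hl hkl
    have h : l < (S.sort (· ≤ ·)).length := by simpa using hl
    rw [List.getD_eq_getElem _ _ h, List.getD_eq_getElem _ _ (hkl.trans h)]
    exact (S.sortedLT_sort).strictMono_get (a := ⟨k, hkl.trans h⟩) (b := ⟨l, h⟩) hkl
  have hinj : ∀ k l, k < S.card → l < S.card →
      (S.sort (· ≤ ·)).getD k 0 = (S.sort (· ≤ ·)).getD l 0 → k = l := by
    intro k l hk hl h
    rcases lt_trichotomy k l with h1 | h1 | h1
    · have := hlt k l hl h1; omega
    · exact h1
    · have := hlt l k hk h1; omega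
  have hsurj : ∀ x ∈ S, ∃ k < S.card, (S.sort (· ≤ ·)).getD k 0 = x := by
    intro x hx
    obtain ⟨k, hk, h⟩ := List.getElem_of_mem ((S.mem_sort (· ≤ ·)).2 hx)
    exact ⟨k, by simpa using hk, by rw [List.getD_eq_getElem _ _ hk, h]⟩
  unfold winv invOn
  refine card_bij (fun p _ => ((S.sort (· ≤ ·)).getD p.1 0, (S.sort (· ≤ ·)).getD p.2 0))
    ?_ ?_ ?_
  · rintro ⟨a, b⟩ h
    simp only [List.length_map, length_sort, mem_filter, mem_product, mem_range] at h ⊢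
    obtain ⟨⟨ha, hb⟩, hab, hf⟩ := h
    rw [hg _ ha, hg _ hb] at hf
    exact ⟨⟨hs _ ha, hs _ hb⟩, hlt _ _ hb hab, hf⟩
  · rintro ⟨a, b⟩ h ⟨a', b'⟩ h' he
    simp only [List.length_map, length_sort, mem_filter, mem_product, mem_range,
      Prod.mk.injEq] at h h' he ⊢
    exact ⟨hinj _ _ h.1.1 h'.1.1 he.1, hinj _ _ h.1.2 h'.1.2 he.2⟩
  · rintro ⟨x, y⟩ h
    simp only [mem_filter, mem_product] at h
    obtain ⟨⟨hx, hy⟩, hxy, hf⟩ := h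
    obtain ⟨a, ha, rfl⟩ := hsurj x hx
    obtain ⟨b, hb, rfl⟩ := hsurj y hy
    refine ⟨(a, b), ?_, rfl⟩
    simp only [List.length_map, length_sort, mem_filter, mem_product, mem_range]
    rw [hg _ ha, hg _ hb]
    refine ⟨⟨ha, hb⟩, ?_, hf⟩
    by_contra! hba
    rcases hba.eq_or_lt with e | e
    · subst e; omega
    · have := hlt _ _ ha e; omega

theorem invOn_congr {S : Finset ℕ} {f g : ℕ → ℕ} (h : ∀ x ∈ S, f x = g x) :
    invOn S f = invOn S g := by
  unfold invOn
  congr 1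
  refine filter_congr fun p hp => ?_
  rw [mem_product] at hp
  rw [h _ hp.1, h _ hp.2]

theorem invOn_eq_of_strictMonoOn {S T : Finset ℕ} {f g φ : ℕ → ℕ}
    (hφ : StrictMonoOn φ (S : Set ℕ)) (hm : ∀ x ∈ S, φ x ∈ T) (hc : S.card = T.card)
    (hfg : ∀ x ∈ S, ∀ y ∈ S, f x < f y ↔ g (φ x) < g (φ y)) :
    invOn S f = invOn T g := by
  have hsurj : Set.SurjOn φ S T :=
    surjOn_of_injOn_of_card_le φ (fun x hx => hm x hx) hφ.injOn hc.ge
  unfold invOn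
  refine card_bij (fun p _ => (φ p.1, φ p.2)) ?_ ?_ ?_
  · rintro ⟨a, b⟩ h
    simp only [mem_filter, mem_product] at h ⊢
    exact ⟨⟨hm _ h.1.1, hm _ h.1.2⟩, hφ h.1.1 h.1.2 h.2.1, (hfg _ h.1.2 _ h.1.1).1 h.2.2⟩
  · rintro ⟨a, b⟩ h ⟨a', b'⟩ h' he
    simp only [mem_filter, mem_product, Prod.mk.injEq] at h h' he ⊢
    exact ⟨hφ.injOn h.1.1 h'.1.1 he.1, hφ.injOn h.1.2 h'.1.2 he.2⟩
  · rintro ⟨x, y⟩ h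
    simp only [mem_filter, mem_product] at h
    obtain ⟨⟨hx, hy⟩, hxy, hf⟩ := h
    obtain ⟨a, ha, rfl⟩ := hsurj hx
    obtain ⟨b, hb, rfl⟩ := hsurj hy
    refine ⟨(a, b), ?_, rfl⟩
    simp only [mem_filter, mem_product]
    exact ⟨⟨ha, hb⟩, (hφ.lt_iff_lt ha hb).1 hxy, (hfg _ hb _ ha).2 hf⟩

theorem invOn_insert_of_min {S : Finset ℕ} {f : ℕ → ℕ} {p : ℕ} (hp : p ∉ S)
    (hmin : ∀ a ∈ S, f p < f a) :
    invOn (insert p S) f = invOn S f + finRank S p := by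
  have hd : (insert p S ×ˢ insert p S).filter (fun q => q.1 < q.2 ∧ f q.2 < f q.1) =
      (S ×ˢ S).filter (fun q => q.1 < q.2 ∧ f q.2 < f q.1) ∪
        (S.filter (· < p)).image fun a => (a, p) := by
    ext ⟨a, b⟩
    simp only [mem_filter, mem_product, mem_insert, mem_union, mem_image, Prod.mk.injEq]
    constructor
    · rintro ⟨⟨rfl | ha, rfl | hb⟩, hab, hf⟩
      · omega
      · have := hmin _ hb; omega
      · exact Or.inr ⟨a, ⟨ha, hab⟩, rfl, rfl⟩
      · exact Or.inl ⟨⟨ha, hb⟩, hab, hf⟩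
    · rintro (⟨⟨ha, hb⟩, hab, hf⟩ | ⟨a, ⟨ha, hab⟩, rfl, rfl⟩)
      · exact ⟨⟨Or.inr ha, Or.inr hb⟩, hab, hf⟩
      · exact ⟨⟨Or.inr ha, Or.inl rfl⟩, hab, hmin _ ha⟩
  unfold invOn finRank
  rw [hd, card_union_of_disjoint, card_image_of_injective]
  · intro a b h
    simpa using h
  · rw [disjoint_left]
    rintro ⟨a, b⟩ h h'
    simp only [mem_filter, mem_product, mem_image, Prod.mk.injEq] at h h'
    obtain ⟨_, _, _, rfl⟩ := h'
    exact hp h.1.2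

/-- The `r`-level excedance places of `h` below `r`. -/
def lowExc (r : ℕ) (h : ℕ → ℕ) : Finset ℕ := (Ico 1 r).filter fun j => r ≤ h j

/-- The excedance places of `h` in `[r, N]`. -/
def highExc (N r : ℕ) (h : ℕ → ℕ) : Finset ℕ := (Icc r N).filter fun j => j < h j

/-- The `r`-level excedance values of `h`. -/
def excVals (N r : ℕ) (h : ℕ → ℕ) : Finset ℕ := (lowExc r h ∪ highExc N r h).image h

/-- The place among `insert i A` which has as many places before it as `i` has after it. -/
noncomputable def pivot (A : Finset ℕ) (i : ℕ) : ℕ :=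
  finSel (insert i A) (A.filter (i < ·)).card

/-- The bijection of positions `[N + 1] → [N + 1]`: it shifts the positions above `r`, sends the
pivot to `N + 1`, and is increasing on the remaining places of `insert i A` (onto `A`) and on the
other places up to `r`. -/
noncomputable def posMap (N r : ℕ) (A : Finset ℕ) (i q : ℕ) : ℕ :=
  if r < q then q - 1
  else if q = pivot A i then N + 1
  else if q ∈ insert i A then ordMap ((insert i A).erase (pivot A i)) A q
  else ordMap (Icc 1 r \ insert i A) (Ico 1 r \ A) q

/-- The cyclic shift of `E ∪ {N + 1}`, fixing all other values. -/
noncomputable def valMap (N : ℕ) (E : Finset ℕ) (v : ℕ) : ℕ :=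
  if v = N + 1 then finSel (insert (N + 1) E) 0
  else if v ∈ E then finSel (insert (N + 1) E) (finRank (insert (N + 1) E) v + 1)
  else v

/-- The word `h` of length `N` extended by `N + 1`. -/
def extWord (N : ℕ) (h : ℕ → ℕ) (q : ℕ) : ℕ := if q ≤ N then h q else N + 1

/-- The word of length `N + 1` obtained from `h` by making `i` a new excedance place. -/
noncomputable def betaWord (N r : ℕ) (h : ℕ → ℕ) (i q : ℕ) : ℕ :=
  valMap N (excVals N r h) (extWord N h (posMap N r (lowExc r h) i q))

section posMap

variable {N r i : ℕ} {A : Finset ℕ}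

theorem card_filter_lt_card_insert (hi : i ∉ A) :
    (A.filter (i < ·)).card < (insert i A).card := by
  rw [card_insert_of_notMem hi]
  exact Nat.lt_succ_of_le (card_le_card (filter_subset _ _))

theorem pivot_mem (hi : i ∉ A) : pivot A i ∈ insert i A :=
  finSel_mem (card_filter_lt_card_insert hi)

theorem finRank_pivot (hi : i ∉ A) :
    finRank (insert i A) (pivot A i) = (A.filter (i < ·)).card :=
  finRank_finSel (card_filter_lt_card_insert hi)

theorem card_erase_pivot (hi : i ∉ A) : ((insert i A).erase (pivot A i)).card = A.card := by
  rw [card_erase_of_mem (pivot_mem hi), card_insert_of_notMem hi, Nat.add_sub_cancel]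

theorem card_sdiff_insert (hA : A ⊆ Ico 1 r) (hi : i ∈ Ico 1 r \ A) :
    (Icc 1 r \ insert i A).card = (Ico 1 r \ A).card := by
  rw [mem_sdiff] at hi
  have h1 : insert i A ⊆ Icc 1 r :=
    (insert_subset hi.1 hA).trans Ico_subset_Icc_self
  rw [card_sdiff_of_subset h1, card_sdiff_of_subset hA, card_insert_of_notMem hi.2]
  simp only [Nat.card_Icc, Nat.card_Ico]
  omega

theorem posMap_of_lt {q : ℕ} (hq : r < q) : posMap N r A i q = q - 1 := if_pos hq

theorem posMap_pivot (hA : A ⊆ Ico 1 r) (hi : i ∈ Ico 1 r \ A) :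
    posMap N r A i (pivot A i) = N + 1 := by
  rw [mem_sdiff] at hi
  have := (insert_subset hi.1 hA) (pivot_mem hi.2)
  rw [mem_Ico] at this
  rw [posMap, if_neg (by omega), if_pos rfl]

theorem posMap_of_mem (hA : A ⊆ Ico 1 r) (hi : i ∈ Ico 1 r \ A) {q : ℕ} (hq : q ∈ insert i A)
    (hp : q ≠ pivot A i) :
    posMap N r A i q = ordMap ((insert i A).erase (pivot A i)) A q := by
  rw [mem_sdiff] at hi
  have := (insert_subset hi.1 hA) hq
  rw [mem_Ico] at this
  rw [posMap, if_neg (by omega), if_neg hp, if_pos hq]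

theorem posMap_of_notMem (hi : i ∈ Ico 1 r \ A) {q : ℕ}
    (hq : q ∈ Icc 1 r \ insert i A) :
    posMap N r A i q = ordMap (Icc 1 r \ insert i A) (Ico 1 r \ A) q := by
  rw [mem_sdiff] at hi hq
  have h1 := mem_Icc.1 hq.1
  rw [posMap, if_neg (by omega), if_neg (fun h : q = pivot A i => hq.2 (h ▸ pivot_mem hi.2)),
    if_neg hq.2]

theorem posMap_mem_of_mem (hA : A ⊆ Ico 1 r) (hi : i ∈ Ico 1 r \ A) {q : ℕ}
    (hq : q ∈ insert i A) (hp : q ≠ pivot A i) : posMap N r A i q ∈ A := by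
  rw [posMap_of_mem hA hi hq hp]
  exact ordMap_mem (card_erase_pivot (mem_sdiff.1 hi).2) (mem_erase.2 ⟨hp, hq⟩)

theorem posMap_mem_of_notMem (hA : A ⊆ Ico 1 r) (hi : i ∈ Ico 1 r \ A) {q : ℕ}
    (hq : q ∈ Icc 1 r \ insert i A) : posMap N r A i q ∈ Ico 1 r \ A := by
  rw [posMap_of_notMem hi hq]
  exact ordMap_mem (card_sdiff_insert hA hi) hq

/-- The four kinds of positions. -/
theorem posMap_cases (hA : A ⊆ Ico 1 r) (hi : i ∈ Ico 1 r \ A) {q : ℕ}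
    (hq : q ∈ Icc 1 (N + 1)) :
    (r < q ∧ q ≤ N + 1 ∧ posMap N r A i q = q - 1) ∨
    (q = pivot A i ∧ 1 ≤ q ∧ q < r ∧ posMap N r A i q = N + 1) ∨
    (q ∈ insert i A ∧ q ≠ pivot A i ∧ 1 ≤ q ∧ q < r ∧ posMap N r A i q ∈ A ∧
      1 ≤ posMap N r A i q ∧ posMap N r A i q < r) ∨
    (q ∈ Icc 1 r \ insert i A ∧ 1 ≤ q ∧ q ≤ r ∧ posMap N r A i q ∈ Ico 1 r \ A ∧
      posMap N r A i q ∉ A ∧ 1 ≤ posMap N r A i q ∧ posMap N r A i q < r) := by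
  rw [mem_Icc] at hq
  have hi' := mem_sdiff.1 hi
  by_cases h1 : r < q
  · exact Or.inl ⟨h1, hq.2, posMap_of_lt h1⟩
  right
  by_cases h2 : q ∈ insert i A
  · have h3 := mem_Ico.1 ((insert_subset hi'.1 hA) h2)
    by_cases h4 : q = pivot A i
    · left
      exact ⟨h4, h3.1, h3.2, by rw [h4, posMap_pivot hA hi]⟩
    · right; left
      have h5 := posMap_mem_of_mem (N := N) hA hi h2 h4
      exact ⟨h2, h4, h3.1, h3.2, h5, mem_Ico.1 (hA h5)⟩
  · right; right
    have h3 : q ∈ Icc 1 r \ insert i A :=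
      mem_sdiff.2 ⟨mem_Icc.2 ⟨hq.1, not_lt.1 h1⟩, h2⟩
    have h4 := posMap_mem_of_notMem (N := N) hA hi h3
    exact ⟨h3, hq.1, not_lt.1 h1, h4, (mem_sdiff.1 h4).2, mem_Ico.1 (mem_sdiff.1 h4).1⟩

theorem posMap_mapsTo (hr : 1 ≤ r) (hrN : r ≤ N) (hA : A ⊆ Ico 1 r) (hi : i ∈ Ico 1 r \ A)
    {q : ℕ} (hq : q ∈ Icc 1 (N + 1)) : posMap N r A i q ∈ Icc 1 (N + 1) := by
  rw [mem_Icc]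
  rcases posMap_cases hA hi hq with h | h | h | h <;> omega

theorem posMap_injOn (hr : 1 ≤ r) (hrN : r ≤ N) (hA : A ⊆ Ico 1 r) (hi : i ∈ Ico 1 r \ A) :
    Set.InjOn (posMap N r A i) (Icc 1 (N + 1) : Finset ℕ) := by
  intro q hq q' hq' he
  have hi' := mem_sdiff.1 hi
  rcases posMap_cases hA hi hq with h | h | h | h <;>
    rcases posMap_cases hA hi hq' with h' | h' | h' | h' <;> try omega
  · rw [posMap_of_mem hA hi h.1 h.2.1, posMap_of_mem hA hi h'.1 h'.2.1] at he
    exact ordMap_inj (card_erase_pivot hi'.2) (mem_erase.2 ⟨h.2.1, h.1⟩)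
      (mem_erase.2 ⟨h'.2.1, h'.1⟩) he
  · rw [he] at h
    exact absurd h.2.2.2.2.1 h'.2.2.2.2.1
  · rw [he] at h
    exact absurd h'.2.2.2.2.1 h.2.2.2.2.1
  · rw [posMap_of_notMem hi h.1, posMap_of_notMem hi h'.1] at he
    exact ordMap_inj (card_sdiff_insert hA hi) h.1 h'.1 he

theorem posMap_surjOn (hr : 1 ≤ r) (hrN : r ≤ N) (hA : A ⊆ Ico 1 r) (hi : i ∈ Ico 1 r \ A) :
    Set.SurjOn (posMap N r A i) (Icc 1 (N + 1) : Finset ℕ) (Icc 1 (N + 1) : Finset ℕ) :=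
  surjOn_of_injOn_of_card_le _ (fun _ hx => posMap_mapsTo hr hrN hA hi hx)
    (posMap_injOn hr hrN hA hi) le_rfl

/-- `posMap` is increasing on the new excedance places other than the pivot. -/
theorem posMap_lt_of_exc (hr : 1 ≤ r) (hA : A ⊆ Ico 1 r) (hi : i ∈ Ico 1 r \ A)
    {q q' : ℕ} (hq : q ∈ insert i A ∧ q ≠ pivot A i ∨ r < q)
    (hq' : q' ∈ insert i A ∧ q' ≠ pivot A i ∨ r < q') (hlt : q < q') :
    posMap N r A i q < posMap N r A i q' := by
  have hi' := mem_sdiff.1 hi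
  have hb := insert_subset hi'.1 hA
  rcases hq with hq | hq <;> rcases hq' with hq' | hq'
  · rw [posMap_of_mem hA hi hq.1 hq.2, posMap_of_mem hA hi hq'.1 hq'.2]
    exact ordMap_lt (card_erase_pivot hi'.2) (mem_erase.2 ⟨hq.2, hq.1⟩)
      (mem_erase.2 ⟨hq'.2, hq'.1⟩) hlt
  · have := mem_Ico.1 (hA (posMap_mem_of_mem (N := N) hA hi hq.1 hq.2))
    rw [posMap_of_lt hq']
    omega
  · have := mem_Ico.1 (hb hq'.1)
    omega
  · rw [posMap_of_lt hq, posMap_of_lt hq']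
    omega

/-- `posMap` is increasing on the places which are not new low excedance places. -/
theorem posMap_lt_of_nexc (hr : 1 ≤ r) (hA : A ⊆ Ico 1 r) (hi : i ∈ Ico 1 r \ A)
    {q q' : ℕ} (h1 : 1 ≤ q) (hq : q ∉ insert i A) (hq' : q' ∉ insert i A) (hlt : q < q') :
    posMap N r A i q < posMap N r A i q' := by
  have key : ∀ x, 1 ≤ x → x ≤ r → x ∉ insert i A → x ∈ Icc 1 r \ insert i A :=
    fun x hx hx' hm => mem_sdiff.2 ⟨mem_Icc.2 ⟨hx, hx'⟩, hm⟩
  by_cases h2 : r < q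
  · rw [posMap_of_lt h2, posMap_of_lt (h2.trans hlt)]
    omega
  · have hm := key q h1 (not_lt.1 h2) hq
    by_cases h3 : r < q'
    · have := posMap_mem_of_notMem (N := N) hA hi hm
      have := mem_Ico.1 (mem_sdiff.1 this).1
      rw [posMap_of_lt h3]
      omega
    · have hm' := key q' (by omega) (not_lt.1 h3) hq'
      rw [posMap_of_notMem hi hm, posMap_of_notMem hi hm']
      exact ordMap_lt (card_sdiff_insert hA hi) hm hm' hlt

end posMap

section valMap

variable {N : ℕ} {E : Finset ℕ}

theorem finRank_add_one_lt (hE : E ⊆ Icc 1 N) {v : ℕ} (hv : v ∈ E) :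
    finRank (insert (N + 1) E) v + 1 < (insert (N + 1) E).card := by
  have h1 : finRank (insert (N + 1) E) v < finRank (insert (N + 1) E) (N + 1) :=
    finRank_lt_finRank (mem_insert_of_mem hv) (Nat.lt_succ_of_le (mem_Icc.1 (hE hv)).2)
  have h2 := finRank_lt_card (mem_insert_self (N + 1) E)
  omega

theorem valMap_last : valMap N E (N + 1) = finSel (insert (N + 1) E) 0 := if_pos rfl

theorem valMap_of_mem (hE : E ⊆ Icc 1 N) {v : ℕ} (hv : v ∈ E) :
    valMap N E v = finSel (insert (N + 1) E) (finRank (insert (N + 1) E) v + 1) := by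
  have := mem_Icc.1 (hE hv)
  rw [valMap, if_neg (by omega), if_pos hv]

theorem valMap_of_notMem {v : ℕ} (hv : v ≠ N + 1) (hv' : v ∉ E) : valMap N E v = v := by
  rw [valMap, if_neg hv, if_neg hv']

theorem valMap_last_mem : valMap N E (N + 1) ∈ insert (N + 1) E := by
  rw [valMap_last]
  exact finSel_mem (card_pos.2 (insert_nonempty _ _))

theorem valMap_mem (hE : E ⊆ Icc 1 N) {v : ℕ} (hv : v ∈ E) : valMap N E v ∈ insert (N + 1) E := by
  rw [valMap_of_mem hE hv]
  exact finSel_mem (finRank_add_one_lt hE hv)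

theorem lt_valMap (hE : E ⊆ Icc 1 N) {v : ℕ} (hv : v ∈ E) : v < valMap N E v := by
  rw [valMap_of_mem hE hv]
  conv_lhs => rw [← finSel_finRank (mem_insert_of_mem (b := N + 1) hv)]
  exact finSel_lt_finSel (Nat.lt_succ_self _) (finRank_add_one_lt hE hv)

theorem valMap_last_lt (hE : E ⊆ Icc 1 N) {v : ℕ} (hv : v ∈ E) :
    valMap N E (N + 1) < valMap N E v := by
  rw [valMap_last, valMap_of_mem hE hv]
  exact finSel_lt_finSel (Nat.succ_pos _) (finRank_add_one_lt hE hv)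

theorem valMap_lt_valMap (hE : E ⊆ Icc 1 N) {v w : ℕ} (hv : v ∈ E) (hw : w ∈ E) (hvw : v < w) :
    valMap N E v < valMap N E w := by
  rw [valMap_of_mem hE hv, valMap_of_mem hE hw]
  exact finSel_lt_finSel (Nat.succ_lt_succ (finRank_lt_finRank (mem_insert_of_mem hv) hvw))
    (finRank_add_one_lt hE hw)

theorem valMap_mapsTo (hE : E ⊆ Icc 1 N) {v : ℕ} (hv : v ∈ Icc 1 (N + 1)) :
    valMap N E v ∈ Icc 1 (N + 1) := by
  have hE' : insert (N + 1) E ⊆ Icc 1 (N + 1) :=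
    insert_subset (by simp) (hE.trans (Icc_subset_Icc_right (Nat.le_succ _)))
  by_cases h1 : v = N + 1
  · rw [h1]
    exact hE' valMap_last_mem
  · by_cases h2 : v ∈ E
    · exact hE' (valMap_mem hE h2)
    · rwa [valMap_of_notMem h1 h2]

theorem valMap_injective (hE : E ⊆ Icc 1 N) : Function.Injective (valMap N E) := by
  have key : ∀ v w, v < w → valMap N E v ≠ valMap N E w := by
    intro v w hvw he
    have hmem : ∀ x, (x = N + 1 ∨ x ∈ E) → valMap N E x ∈ insert (N + 1) E := by
      rintro x (rfl | hx)
      · exact valMap_last_mem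
      · exact valMap_mem hE hx
    by_cases hv : v = N + 1 ∨ v ∈ E <;> by_cases hw : w = N + 1 ∨ w ∈ E
    · rcases hv with rfl | hv <;> rcases hw with rfl | hw
      · omega
      · have := mem_Icc.1 (hE hw); omega
      · exact absurd he (valMap_last_lt hE hv).ne'
      · exact absurd he (valMap_lt_valMap hE hv hw hvw).ne
    · have h1 := hmem v hv
      push Not at hw
      rw [he, valMap_of_notMem hw.1 hw.2, mem_insert] at h1
      exact h1.elim hw.1 hw.2
    · have h1 := hmem w hw
      push Not at hv
      rw [← he, valMap_of_notMem hv.1 hv.2, mem_insert] at h1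
      exact h1.elim hv.1 hv.2
    · push Not at hv hw
      rw [valMap_of_notMem hv.1 hv.2, valMap_of_notMem hw.1 hw.2] at he
      omega
  intro v w he
  rcases lt_trichotomy v w with h | h | h
  · exact absurd he (key v w h)
  · exact h
  · exact absurd he.symm (key w v h)

end valMap

theorem mem_lowExc {r j : ℕ} {h : ℕ → ℕ} : j ∈ lowExc r h ↔ (1 ≤ j ∧ j < r) ∧ r ≤ h j := by
  rw [lowExc, mem_filter, mem_Ico]

theorem mem_highExc {N r j : ℕ} {h : ℕ → ℕ} :
    j ∈ highExc N r h ↔ (r ≤ j ∧ j ≤ N) ∧ j < h j := by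
  rw [highExc, mem_filter, mem_Icc]

theorem lowExc_subset (r : ℕ) (h : ℕ → ℕ) : lowExc r h ⊆ Ico 1 r := filter_subset _ _

theorem disjoint_lowExc_highExc (N r : ℕ) (h : ℕ → ℕ) :
    Disjoint (lowExc r h) (highExc N r h) := by
  rw [disjoint_left]
  intro j h1 h2
  rw [mem_lowExc] at h1
  rw [mem_highExc] at h2
  omega

/-- The `r`-level excedance places of `betaWord N r h i`. -/
def betaExc (N r : ℕ) (h : ℕ → ℕ) (i : ℕ) : Finset ℕ :=
  insert i (lowExc r h) ∪ (highExc N r h).image (· + 1)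

section betaWord

variable {N r i : ℕ} {h : ℕ → ℕ}

theorem mem_excVals_iff (hr : 1 ≤ r) (hrN : r ≤ N)
    (hinj : Set.InjOn h (Icc 1 N : Finset ℕ)) {j : ℕ} (hj : j ∈ Icc 1 N) :
    h j ∈ excVals N r h ↔ j ∈ lowExc r h ∪ highExc N r h := by
  refine ⟨fun hm => ?_, fun hm => mem_image_of_mem _ hm⟩
  obtain ⟨k, hk, he⟩ := mem_image.1 hm
  have hk' : k ∈ Icc 1 N := by
    rw [mem_Icc]
    rcases mem_union.1 hk with h1 | h1
    · rw [mem_lowExc] at h1; omega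
    · rw [mem_highExc] at h1; omega
  rwa [← hinj hk' hj he]

theorem excVals_subset (hr : 1 ≤ r) (hrN : r ≤ N) (hm : ∀ j ∈ Icc 1 N, h j ∈ Icc 1 N) :
    excVals N r h ⊆ Icc 1 N := by
  intro v hv
  obtain ⟨k, hk, rfl⟩ := mem_image.1 hv
  apply hm
  rw [mem_Icc]
  rcases mem_union.1 hk with h1 | h1
  · rw [mem_lowExc] at h1; omega
  · rw [mem_highExc] at h1; omega

theorem le_of_mem_excVals {v : ℕ} (hv : v ∈ excVals N r h) : r ≤ v := by
  obtain ⟨k, hk, rfl⟩ := mem_image.1 hv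
  rcases mem_union.1 hk with h1 | h1
  · rw [mem_lowExc] at h1; omega
  · rw [mem_highExc] at h1; omega

theorem betaWord_pivot (hi : i ∈ Ico 1 r \ lowExc r h) :
    betaWord N r h i (pivot (lowExc r h) i) = valMap N (excVals N r h) (N + 1) := by
  rw [betaWord, posMap_pivot (lowExc_subset r h) hi, extWord, if_neg (by omega)]

theorem betaWord_of_posMap_le {q : ℕ} (hq : posMap N r (lowExc r h) i q ≤ N) :
    betaWord N r h i q = valMap N (excVals N r h) (h (posMap N r (lowExc r h) i q)) := by
  rw [betaWord, extWord, if_pos hq]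

/-- The kinds of positions of `betaWord`: the pivot, the other excedance places, and the rest. -/
theorem betaWord_cases (hr : 1 ≤ r) (hrN : r ≤ N) (hm : ∀ j ∈ Icc 1 N, h j ∈ Icc 1 N)
    (hinj : Set.InjOn h (Icc 1 N : Finset ℕ)) (hi : i ∈ Ico 1 r \ lowExc r h)
    {q : ℕ} (hq : q ∈ Icc 1 (N + 1)) :
    (q = pivot (lowExc r h) i ∧ q ∈ betaExc N r h i ∧ q < r ∧ r ≤ betaWord N r h i q) ∨
    (q ∈ betaExc N r h i ∧ q ≠ pivot (lowExc r h) i ∧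
      posMap N r (lowExc r h) i q ∈ lowExc r h ∪ highExc N r h ∧
      h (posMap N r (lowExc r h) i q) ∈ excVals N r h ∧
      betaWord N r h i q = valMap N (excVals N r h) (h (posMap N r (lowExc r h) i q)) ∧
      r ≤ h (posMap N r (lowExc r h) i q) ∧
      h (posMap N r (lowExc r h) i q) < betaWord N r h i q ∧
      q ≤ h (posMap N r (lowExc r h) i q) ∧ q ≠ r) ∨
    (q ∉ betaExc N r h i ∧ posMap N r (lowExc r h) i q ∈ Icc 1 N ∧
      posMap N r (lowExc r h) i q ∉ lowExc r h ∪ highExc N r h ∧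
      betaWord N r h i q = h (posMap N r (lowExc r h) i q) ∧
      (q ≤ r → betaWord N r h i q < r) ∧ (r < q → betaWord N r h i q < q)) := by
  have hA := lowExc_subset r h
  have hE := excVals_subset hr hrN hm
  have hi' := mem_sdiff.1 hi
  have hexc : ∀ q, r < q → (q ∈ betaExc N r h i ↔ q - 1 ∈ highExc N r h) := by
    intro q hq
    rw [betaExc, mem_union, mem_image]
    constructor
    · rintro (h1 | ⟨k, hk, rfl⟩)
      · have := mem_Ico.1 (insert_subset hi'.1 hA h1)
        omega
      · exact hk
    · exact fun h1 => Or.inr ⟨q - 1, h1, by omega⟩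
  have hexc' : ∀ q, q ≤ r → (q ∈ betaExc N r h i ↔ q ∈ insert i (lowExc r h)) := by
    intro q hq
    rw [betaExc, mem_union, mem_image]
    refine ⟨?_, Or.inl⟩
    rintro (h1 | ⟨k, hk, rfl⟩)
    · exact h1
    · rw [mem_highExc] at hk
      omega
  have hpiv := mem_Ico.1 (insert_subset hi'.1 hA (pivot_mem hi'.2))
  have hnexc : ∀ j ∈ Icc 1 N, j ∉ lowExc r h ∪ highExc N r h →
      valMap N (excVals N r h) (h j) = h j := by
    intro j hj hj'
    have := mem_Icc.1 (hm j hj)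
    exact valMap_of_notMem (by omega) fun hc => hj' ((mem_excVals_iff hr hrN hinj hj).1 hc)
  rcases posMap_cases (N := N) hA hi hq with h1 | h1 | h1 | h1
  · obtain ⟨h1, h2, h3⟩ := h1
    have hb := betaWord_of_posMap_le (N := N) (r := r) (h := h) (i := i) (q := q) (by omega)
    rw [h3] at hb ⊢
    right
    have hj : q - 1 ∈ Icc 1 N := by rw [mem_Icc]; omega
    by_cases h4 : q - 1 ∈ highExc N r h
    · left
      have h5 : q - 1 ∈ lowExc r h ∪ highExc N r h := mem_union_right _ h4
      have h6 := (mem_excVals_iff hr hrN hinj hj).2 h5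
      have h7 := lt_valMap hE h6
      rw [← hb] at h7
      have h8 := mem_highExc.1 h4
      exact ⟨(hexc q h1).2 h4, by omega, h5, h6, hb, le_of_mem_excVals h6, h7, by omega, by omega⟩
    · right
      have h5 : q - 1 ∉ lowExc r h ∪ highExc N r h := by
        rw [mem_union, mem_lowExc]
        rintro (h5 | h5)
        · omega
        · exact h4 h5
      rw [hnexc _ hj h5] at hb
      rw [mem_highExc] at h4
      exact ⟨fun hc => h5 (mem_union_right _ ((hexc q h1).1 hc)), hj, h5, hb, by omega, by omega⟩
  · left
    refine ⟨h1.1, ?_, h1.2.2.1, ?_⟩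
    · rw [hexc' q (by omega), h1.1]
      exact pivot_mem hi'.2
    · rw [h1.1, betaWord_pivot hi]
      rcases mem_insert.1 (valMap_last_mem (N := N) (E := excVals N r h)) with h2 | h2
      · omega
      · exact le_of_mem_excVals h2
  · right; left
    obtain ⟨h1, h2, h3, h4, h5, h6, h7⟩ := h1
    have hb := betaWord_of_posMap_le (N := N) (r := r) (h := h) (i := i) (q := q) (by omega)
    have h8 := mem_union_left (highExc N r h) h5
    have h9 := (mem_excVals_iff hr hrN hinj (by rw [mem_Icc]; omega)).2 h8
    have h10 := lt_valMap hE h9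
    rw [← hb] at h10
    have h11 := le_of_mem_excVals h9
    exact ⟨(hexc' q (by omega)).2 h1, h2, h8, h9, hb, h11, h10, by omega, by omega⟩
  · right; right
    obtain ⟨h1, h2, h3, h4, h5, h6, h7⟩ := h1
    have hj : posMap N r (lowExc r h) i q ∈ Icc 1 N := by rw [mem_Icc]; omega
    have hb := betaWord_of_posMap_le (N := N) (r := r) (h := h) (i := i) (q := q) (by omega)
    have h8 : posMap N r (lowExc r h) i q ∉ lowExc r h ∪ highExc N r h := by
      rw [mem_union, mem_highExc]
      rintro (h8 | h8)
      · exact h5 h8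
      · omega
    rw [hnexc _ hj h8] at hb
    rw [mem_lowExc] at h5
    exact ⟨fun hc => (mem_sdiff.1 h1).2 ((hexc' q h3).1 hc), hj, h8, hb, by omega, by omega⟩

theorem betaExc_subset (hrN : r ≤ N) (hi : i ∈ Ico 1 r \ lowExc r h) :
    betaExc N r h i ⊆ Icc 1 (N + 1) := by
  intro q hq
  rw [mem_sdiff, mem_Ico] at hi
  rw [betaExc, mem_union, mem_insert, mem_image, mem_lowExc] at hq
  rw [mem_Icc]
  rcases hq with (rfl | h1) | ⟨k, hk, rfl⟩
  · omega
  · omega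
  · rw [mem_highExc] at hk
    omega

theorem mem_betaExc_iff (hr : 1 ≤ r) (hrN : r ≤ N) (hm : ∀ j ∈ Icc 1 N, h j ∈ Icc 1 N)
    (hinj : Set.InjOn h (Icc 1 N : Finset ℕ)) (hi : i ∈ Ico 1 r \ lowExc r h)
    {q : ℕ} (hq : q ∈ Icc 1 (N + 1)) :
    q ∈ betaExc N r h i ↔ q < betaWord N r h i q ∧ r ≤ betaWord N r h i q := by
  rcases betaWord_cases hr hrN hm hinj hi hq with h1 | h1 | h1
  · exact iff_of_true h1.2.1 (by omega)
  · exact iff_of_true h1.1 (by omega)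
  · refine iff_of_false h1.1 fun h2 => ?_
    rcases le_or_gt q r with h3 | h3
    · have := h1.2.2.2.2.1 h3; omega
    · have := h1.2.2.2.2.2 h3; omega

theorem betaWord_mapsTo (hr : 1 ≤ r) (hrN : r ≤ N) (hm : ∀ j ∈ Icc 1 N, h j ∈ Icc 1 N)
    (hi : i ∈ Ico 1 r \ lowExc r h) {q : ℕ} (hq : q ∈ Icc 1 (N + 1)) :
    betaWord N r h i q ∈ Icc 1 (N + 1) := by
  refine valMap_mapsTo (excVals_subset hr hrN hm) ?_
  have h1 := posMap_mapsTo hr hrN (lowExc_subset r h) hi hq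
  rw [mem_Icc] at h1
  rw [extWord]
  split_ifs with h2
  · exact Icc_subset_Icc_right (Nat.le_succ _) (hm _ (mem_Icc.2 ⟨h1.1, h2⟩))
  · simp

theorem betaWord_injOn (hr : 1 ≤ r) (hrN : r ≤ N) (hm : ∀ j ∈ Icc 1 N, h j ∈ Icc 1 N)
    (hinj : Set.InjOn h (Icc 1 N : Finset ℕ)) (hi : i ∈ Ico 1 r \ lowExc r h) :
    Set.InjOn (betaWord N r h i) (Icc 1 (N + 1) : Finset ℕ) := by
  intro q hq q' hq' he
  have h1 := mem_Icc.1 (posMap_mapsTo hr hrN (lowExc_subset r h) hi hq)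
  have h1' := mem_Icc.1 (posMap_mapsTo hr hrN (lowExc_subset r h) hi hq')
  have h2 := valMap_injective (excVals_subset hr hrN hm) he
  apply posMap_injOn hr hrN (lowExc_subset r h) hi hq hq'
  rw [extWord, extWord] at h2
  split_ifs at h2 with h3 h4 h4
  · exact hinj (mem_coe.2 (mem_Icc.2 ⟨h1.1, h3⟩)) (mem_coe.2 (mem_Icc.2 ⟨h1'.1, h4⟩)) h2
  · have := mem_Icc.1 (hm _ (mem_Icc.2 ⟨h1.1, h3⟩)); omega
  · have := mem_Icc.1 (hm _ (mem_Icc.2 ⟨h1'.1, h4⟩)); omega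
  · omega

theorem betaWord_pivot_lt (hr : 1 ≤ r) (hrN : r ≤ N) (hm : ∀ j ∈ Icc 1 N, h j ∈ Icc 1 N)
    (hinj : Set.InjOn h (Icc 1 N : Finset ℕ)) (hi : i ∈ Ico 1 r \ lowExc r h)
    {q : ℕ} (hq : q ∈ betaExc N r h i) (hp : q ≠ pivot (lowExc r h) i) :
    betaWord N r h i (pivot (lowExc r h) i) < betaWord N r h i q := by
  rcases betaWord_cases hr hrN hm hinj hi (betaExc_subset hrN hi hq) with h1 | h1 | h1
  · exact absurd h1.1 hp
  · rw [betaWord_pivot hi, h1.2.2.2.2.1]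
    exact valMap_last_lt (excVals_subset hr hrN hm) h1.2.2.2.1
  · exact absurd hq h1.1

/-- The `r`-level excedance values of `h` are excedance values of `betaWord N r h i`. -/
theorem exists_betaWord_eq (hr : 1 ≤ r) (hrN : r ≤ N) (hm : ∀ j ∈ Icc 1 N, h j ∈ Icc 1 N)
    (hinj : Set.InjOn h (Icc 1 N : Finset ℕ)) (hi : i ∈ Ico 1 r \ lowExc r h)
    {v : ℕ} (hv : v ∈ excVals N r h) :
    ∃ q ∈ betaExc N r h i, betaWord N r h i q = v := by
  have hv' := excVals_subset hr hrN hm hv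
  obtain ⟨q, hq, rfl⟩ := surjOn_of_injOn_of_card_le _
    (fun _ hx => betaWord_mapsTo hr hrN hm hi hx) (betaWord_injOn hr hrN hm hinj hi) le_rfl
    (Icc_subset_Icc_right (Nat.le_succ _) hv')
  refine ⟨q, ?_, rfl⟩
  rcases betaWord_cases hr hrN hm hinj hi hq with h1 | h1 | h1
  · exact h1.2.1
  · exact h1.1
  · change betaWord N r h i q ∈ excVals N r h at hv
    rw [h1.2.2.2.1, mem_excVals_iff hr hrN hinj h1.2.1] at hv
    exact absurd hv h1.2.2.1

theorem card_highExc_image : ((highExc N r h).image (· + 1)).card = (highExc N r h).card :=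
  card_image_of_injective _ (add_left_injective 1)

theorem disjoint_betaExc (hi : i ∈ Ico 1 r \ lowExc r h) :
    Disjoint (insert i (lowExc r h)) ((highExc N r h).image (· + 1)) := by
  rw [mem_sdiff, mem_Ico] at hi
  rw [disjoint_left]
  intro q h1 h2
  obtain ⟨k, hk, rfl⟩ := mem_image.1 h2
  rw [mem_highExc] at hk
  rw [mem_insert, mem_lowExc] at h1
  omega

theorem card_betaExc (hi : i ∈ Ico 1 r \ lowExc r h) :
    (betaExc N r h i).card = (lowExc r h ∪ highExc N r h).card + 1 := by
  rw [betaExc, card_union_of_disjoint (disjoint_betaExc hi), card_highExc_image,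
    card_insert_of_notMem (mem_sdiff.1 hi).2,
    card_union_of_disjoint (disjoint_lowExc_highExc N r h)]
  omega

theorem sum_betaExc (hi : i ∈ Ico 1 r \ lowExc r h) :
    ∑ q ∈ betaExc N r h i, q =
      ∑ q ∈ lowExc r h ∪ highExc N r h, q + (highExc N r h).card + i := by
  rw [betaExc, sum_union (disjoint_betaExc hi), sum_insert (mem_sdiff.1 hi).2,
    sum_union (disjoint_lowExc_highExc N r h), sum_image (by simp), sum_add_distrib]
  simp
  omega

theorem finRank_betaExc_pivot (hi : i ∈ Ico 1 r \ lowExc r h) :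
    finRank ((betaExc N r h i).erase (pivot (lowExc r h) i)) (pivot (lowExc r h) i) =
      ((lowExc r h).filter (i < ·)).card := by
  have hi' := mem_sdiff.1 hi
  have hpiv := mem_Ico.1 (insert_subset hi'.1 (lowExc_subset r h) (pivot_mem hi'.2))
  rw [← finRank_pivot hi'.2, finRank, finRank]
  congr 1
  ext q
  simp only [mem_filter, mem_erase, betaExc, mem_union, mem_image, mem_highExc]
  constructor
  · rintro ⟨⟨_, h1 | ⟨k, hk, rfl⟩⟩, h2⟩
    · exact ⟨h1, h2⟩
    · omega
  · rintro ⟨h1, h2⟩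
    exact ⟨⟨h2.ne, Or.inl h1⟩, h2⟩

theorem invOn_betaExc (hr : 1 ≤ r) (hrN : r ≤ N) (hm : ∀ j ∈ Icc 1 N, h j ∈ Icc 1 N)
    (hinj : Set.InjOn h (Icc 1 N : Finset ℕ)) (hi : i ∈ Ico 1 r \ lowExc r h) :
    invOn (betaExc N r h i) (betaWord N r h i) =
      invOn (lowExc r h ∪ highExc N r h) h + ((lowExc r h).filter (i < ·)).card := by
  have hA := lowExc_subset r h
  have hE := excVals_subset hr hrN hm
  have hp : pivot (lowExc r h) i ∈ betaExc N r h i :=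
    mem_union_left _ (pivot_mem (mem_sdiff.1 hi).2)
  rw [← insert_erase hp, invOn_insert_of_min (notMem_erase _ _)
    fun a ha => betaWord_pivot_lt hr hrN hm hinj hi (mem_of_mem_erase ha) (ne_of_mem_erase ha),
    finRank_betaExc_pivot hi]
  congr 1
  have hd : ∀ q ∈ (betaExc N r h i).erase (pivot (lowExc r h) i),
      posMap N r (lowExc r h) i q ∈ lowExc r h ∪ highExc N r h ∧
      h (posMap N r (lowExc r h) i q) ∈ excVals N r h ∧
      betaWord N r h i q = valMap N (excVals N r h) (h (posMap N r (lowExc r h) i q)) := by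
    intro q hq
    rw [mem_erase] at hq
    rcases betaWord_cases hr hrN hm hinj hi (betaExc_subset hrN hi hq.2) with h1 | h1 | h1
    · exact absurd h1.1 hq.1
    · exact ⟨h1.2.2.1, h1.2.2.2.1, h1.2.2.2.2.1⟩
    · exact absurd hq.2 h1.1
  have hs : StrictMonoOn (valMap N (excVals N r h)) (excVals N r h : Set ℕ) :=
    fun v hv w hw => valMap_lt_valMap hE hv hw
  have hk : ∀ q ∈ (betaExc N r h i).erase (pivot (lowExc r h) i),
      q ∈ insert i (lowExc r h) ∧ q ≠ pivot (lowExc r h) i ∨ r < q := by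
    intro q hq
    rw [mem_erase, betaExc, mem_union, mem_image] at hq
    rcases hq with ⟨h1, h2 | ⟨k, hk, rfl⟩⟩
    · exact Or.inl ⟨h2, h1⟩
    · rw [mem_highExc] at hk
      omega
  refine invOn_eq_of_strictMonoOn (φ := posMap N r (lowExc r h) i) ?_ (fun q hq => (hd q hq).1)
    (by rw [card_erase_of_mem hp, card_betaExc hi, Nat.add_sub_cancel]) ?_
  · exact fun q hq q' hq' hlt => posMap_lt_of_exc hr hA hi (hk q hq) (hk q' hq') hlt
  · intro q hq q' hq'
    rw [(hd q hq).2.2, (hd q' hq').2.2]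
    exact hs.lt_iff_lt (hd q hq).2.1 (hd q' hq').2.1

theorem invOn_compl_betaExc (hr : 1 ≤ r) (hrN : r ≤ N) (hm : ∀ j ∈ Icc 1 N, h j ∈ Icc 1 N)
    (hinj : Set.InjOn h (Icc 1 N : Finset ℕ)) (hi : i ∈ Ico 1 r \ lowExc r h) :
    invOn (Icc 1 (N + 1) \ betaExc N r h i) (betaWord N r h i) =
      invOn (Icc 1 N \ (lowExc r h ∪ highExc N r h)) h := by
  have hA := lowExc_subset r h
  have hd : ∀ q ∈ Icc 1 (N + 1) \ betaExc N r h i,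
      posMap N r (lowExc r h) i q ∈ Icc 1 N \ (lowExc r h ∪ highExc N r h) ∧
      betaWord N r h i q = h (posMap N r (lowExc r h) i q) := by
    intro q hq
    rw [mem_sdiff] at hq
    rcases betaWord_cases hr hrN hm hinj hi hq.1 with h1 | h1 | h1
    · exact absurd h1.2.1 hq.2
    · exact absurd h1.1 hq.2
    · exact ⟨mem_sdiff.2 ⟨h1.2.1, h1.2.2.1⟩, h1.2.2.2.1⟩
  have hs : lowExc r h ∪ highExc N r h ⊆ Icc 1 N := by
    intro j hj
    rw [mem_union, mem_lowExc, mem_highExc] at hj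
    rw [mem_Icc]
    omega
  refine invOn_eq_of_strictMonoOn (φ := posMap N r (lowExc r h) i) ?_ (fun q hq => (hd q hq).1)
    ?_ ?_
  · intro q hq q' hq' hlt
    rw [mem_coe, mem_sdiff, betaExc, mem_union, not_or] at hq hq'
    exact posMap_lt_of_nexc hr hA hi (mem_Icc.1 hq.1).1 hq.2.1 hq'.2.1 hlt
  · rw [card_sdiff_of_subset (betaExc_subset hrN hi), card_sdiff_of_subset hs, card_betaExc hi]
    simp
  · intro q hq q' hq'
    rw [(hd q hq).2, (hd q' hq').2]

end betaWord

section recover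

variable {N r i : ℕ} {h : ℕ → ℕ}

theorem filter_lt_betaExc (hi : i ∈ Ico 1 r \ lowExc r h) :
    (betaExc N r h i).filter (· < r) = insert i (lowExc r h) := by
  rw [mem_sdiff, mem_Ico] at hi
  ext q
  simp only [mem_filter, betaExc, mem_union, mem_image, mem_insert, mem_highExc, mem_lowExc]
  constructor
  · rintro ⟨h1 | ⟨k, hk, rfl⟩, h2⟩
    · exact h1
    · omega
  · exact fun h1 => ⟨Or.inl h1, by omega⟩

theorem filter_le_betaExc (hi : i ∈ Ico 1 r \ lowExc r h) :
    (betaExc N r h i).filter (r ≤ ·) = (highExc N r h).image (· + 1) := by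
  rw [mem_sdiff, mem_Ico] at hi
  ext q
  simp only [mem_filter, betaExc, mem_union, mem_image, mem_insert, mem_highExc, mem_lowExc]
  constructor
  · rintro ⟨h1 | h1, h2⟩
    · omega
    · exact h1
  · rintro ⟨k, hk, rfl⟩
    exact ⟨Or.inr ⟨k, hk, rfl⟩, by omega⟩

theorem excVals_eq_erase_image (hr : 1 ≤ r) (hrN : r ≤ N) (hm : ∀ j ∈ Icc 1 N, h j ∈ Icc 1 N)
    (hinj : Set.InjOn h (Icc 1 N : Finset ℕ)) (hi : i ∈ Ico 1 r \ lowExc r h) :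
    excVals N r h = ((betaExc N r h i).image (betaWord N r h i)).erase (N + 1) := by
  have hE := excVals_subset hr hrN hm
  ext v
  rw [mem_erase, mem_image]
  constructor
  · intro hv
    have := mem_Icc.1 (hE hv)
    exact ⟨by omega, exists_betaWord_eq hr hrN hm hinj hi hv⟩
  · rintro ⟨h1, q, hq, rfl⟩
    refine mem_of_mem_insert_of_ne ?_ h1
    rcases betaWord_cases hr hrN hm hinj hi (betaExc_subset hrN hi hq) with h2 | h2 | h2
    · rw [h2.1, betaWord_pivot hi]
      exact valMap_last_mem
    · rw [h2.2.2.2.2.1]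
      exact valMap_mem hE h2.2.2.2.1
    · exact absurd hq h2.1

/-- The word `h` and the place `i` can be recovered from `betaWord N r h i`. -/
theorem betaWord_injective {i' : ℕ} {h' : ℕ → ℕ} (hr : 1 ≤ r) (hrN : r ≤ N)
    (hm : ∀ j ∈ Icc 1 N, h j ∈ Icc 1 N) (hm' : ∀ j ∈ Icc 1 N, h' j ∈ Icc 1 N)
    (hinj : Set.InjOn h (Icc 1 N : Finset ℕ)) (hinj' : Set.InjOn h' (Icc 1 N : Finset ℕ))
    (hi : i ∈ Ico 1 r \ lowExc r h) (hi' : i' ∈ Ico 1 r \ lowExc r h')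
    (he : ∀ q ∈ Icc 1 (N + 1), betaWord N r h i q = betaWord N r h' i' q) :
    ∀ j ∈ Icc 1 N, h j = h' j := by
  have hX : betaExc N r h i = betaExc N r h' i' := by
    ext q
    by_cases hq : q ∈ Icc 1 (N + 1)
    · rw [mem_betaExc_iff hr hrN hm hinj hi hq, mem_betaExc_iff hr hrN hm' hinj' hi' hq, he q hq]
    · exact iff_of_false (fun hc => hq (betaExc_subset hrN hi hc))
        (fun hc => hq (betaExc_subset hrN hi' hc))
  have hA' : insert i (lowExc r h) = insert i' (lowExc r h') := by
    rw [← filter_lt_betaExc (N := N) hi, ← filter_lt_betaExc (N := N) hi', hX]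
  have hni := (mem_sdiff.1 hi).2
  have hni' := (mem_sdiff.1 hi').2
  have hp : pivot (lowExc r h) i ∈ betaExc N r h i := mem_union_left _ (pivot_mem hni)
  have hp' : pivot (lowExc r h') i' ∈ betaExc N r h' i' := mem_union_left _ (pivot_mem hni')
  have hpp : pivot (lowExc r h) i = pivot (lowExc r h') i' := by
    by_contra hne
    have h1 := betaWord_pivot_lt hr hrN hm hinj hi (hX ▸ hp') (Ne.symm hne)
    have h2 := betaWord_pivot_lt hr hrN hm' hinj' hi' (hX ▸ hp) hne
    rw [he _ (betaExc_subset hrN hi hp), he _ (betaExc_subset hrN hi' hp')] at h1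
    omega
  have hins : ∀ (A : Finset ℕ) (a : ℕ), (insert a A).filter (a < ·) = A.filter (a < ·) := by
    intro A a
    rw [filter_insert, if_neg (lt_irrefl a)]
  have hc : ((insert i (lowExc r h)).filter (i < ·)).card =
      ((insert i (lowExc r h)).filter (i' < ·)).card := by
    conv_rhs => rw [hA']
    rw [hins, hins, ← finRank_pivot hni, ← finRank_pivot hni', hA', hpp]
  have hlt : ∀ (S : Finset ℕ) (a b : ℕ), b ∈ S → a < b →
      (S.filter (b < ·)).card < (S.filter (a < ·)).card := by
    intro S a b hb hab
    refine card_lt_card ⟨fun x hx => ?_, fun hs => ?_⟩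
    · rw [mem_filter] at hx ⊢
      exact ⟨hx.1, hab.trans hx.2⟩
    · exact lt_irrefl b (mem_filter.1 (hs (mem_filter.2 ⟨hb, hab⟩))).2
  have hii : i = i' := by
    rcases lt_trichotomy i i' with h1 | h1 | h1
    · exact absurd hc (hlt _ _ _ (hA' ▸ mem_insert_self i' _) h1).ne'
    · exact h1
    · exact absurd hc (hlt _ _ _ (mem_insert_self i _) h1).ne
  subst hii
  have hA : lowExc r h = lowExc r h' := by
    rw [← erase_insert hni, hA', erase_insert hni']
  have hE : excVals N r h = excVals N r h' := by
    rw [excVals_eq_erase_image hr hrN hm hinj hi, excVals_eq_erase_image hr hrN hm' hinj' hi', hX]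
    congr 1
    exact image_congr fun q hq => he q (betaExc_subset hrN hi' hq)
  intro j hj
  obtain ⟨q, hq, hqj⟩ := posMap_surjOn hr hrN (lowExc_subset r h) hi
    (mem_coe.2 (Icc_subset_Icc_right (Nat.le_succ _) hj))
  have h1 := he q hq
  rw [betaWord, betaWord, ← hA, ← hE, hqj, extWord, extWord, if_pos (mem_Icc.1 hj).2,
    if_pos (mem_Icc.1 hj).2] at h1
  exact valMap_injective (excVals_subset hr hrN hm) h1

theorem exists_place {c : ℕ} (hc : (lowExc r h ∪ highExc N r h).card < c)
    (hc' : c ≤ (highExc N r h).card + r - 1) :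
    ∃ i ∈ Ico 1 r \ lowExc r h,
      (highExc N r h).card + i + ((lowExc r h).filter (i < ·)).card = c := by
  rw [card_union_of_disjoint (disjoint_lowExc_highExc N r h)] at hc
  have hS := card_sdiff_of_subset (lowExc_subset r h)
  rw [Nat.card_Ico] at hS
  have hk : c - (highExc N r h).card - (lowExc r h).card - 1 < (Ico 1 r \ lowExc r h).card := by
    omega
  have hi := finSel_mem hk
  have hrk := finRank_finSel hk
  generalize finSel (Ico 1 r \ lowExc r h) _ = i at hi hrk
  refine ⟨i, hi, ?_⟩
  have hi' := mem_sdiff.1 hi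
  have hir := mem_Ico.1 hi'.1
  have h1 : finRank (Ico 1 r \ lowExc r h) i + finRank (lowExc r h) i = i - 1 := by
    have hd : Ico 1 i = (Ico 1 r \ lowExc r h).filter (· < i) ∪ (lowExc r h).filter (· < i) := by
      rw [← filter_union, sdiff_union_of_subset (lowExc_subset r h)]
      ext x
      simp only [mem_Ico, mem_filter]
      omega
    rw [finRank, finRank, ← card_union_of_disjoint, ← hd, Nat.card_Ico]
    exact disjoint_filter_filter sdiff_disjoint
  have h2 : finRank (lowExc r h) i + ((lowExc r h).filter (i < ·)).card = (lowExc r h).card := by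
    rw [finRank, ← card_filter_add_card_filter_not (s := lowExc r h) (· < i)]
    congr 2
    refine filter_congr fun x hx => ?_
    have : x ≠ i := fun e => hi'.2 (e ▸ hx)
    omega
  omega

end recover

theorem pval_mem {n : ℕ} (π : Equiv.Perm (Fin n)) {j : ℕ} (hj : j ∈ Icc 1 n) :
    pval π j ∈ Icc 1 n := by
  rw [mem_Icc] at hj ⊢
  rw [pval, dif_pos hj]
  omega

theorem pval_injOn {n : ℕ} (π : Equiv.Perm (Fin n)) :
    Set.InjOn (pval π) (Icc 1 n : Finset ℕ) := by
  intro a ha b hb he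
  rw [mem_coe, mem_Icc] at ha hb
  rw [pval, pval, dif_pos ha, dif_pos hb, Nat.add_right_cancel_iff, Fin.val_inj,
    π.injective.eq_iff, Fin.mk.injEq] at he
  omega

theorem perm_ext_pval {n : ℕ} {π τ : Equiv.Perm (Fin n)}
    (h : ∀ j ∈ Icc 1 n, pval π j = pval τ j) : π = τ := by
  ext k
  have hk : 1 ≤ (k : ℕ) + 1 ∧ (k : ℕ) + 1 ≤ n := by omega
  have := h (k + 1) (mem_Icc.2 hk)
  rw [pval, pval, dif_pos hk, dif_pos hk] at this
  simpa using this

theorem exists_perm_pval_eq {n : ℕ} {f : ℕ → ℕ} (hm : ∀ j ∈ Icc 1 n, f j ∈ Icc 1 n)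
    (hinj : Set.InjOn f (Icc 1 n : Finset ℕ)) :
    ∃ τ : Equiv.Perm (Fin n), ∀ j ∈ Icc 1 n, pval τ j = f j := by
  have hk : ∀ k : Fin n, (k : ℕ) + 1 ∈ Icc 1 n := fun k => by rw [mem_Icc]; omega
  have hf : ∀ k : Fin n, f (k + 1) - 1 < n := fun k => by
    have := mem_Icc.1 (hm _ (hk k)); omega
  have hb : Function.Injective fun k : Fin n => (⟨f (k + 1) - 1, hf k⟩ : Fin n) := by
    intro a b hab
    have h1 := mem_Icc.1 (hm _ (hk a))
    have h2 := mem_Icc.1 (hm _ (hk b))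
    rw [Fin.mk.injEq] at hab
    have := hinj (mem_coe.2 (hk a)) (mem_coe.2 (hk b)) (by omega)
    exact Fin.ext (by omega)
  refine ⟨Equiv.ofBijective _ (Finite.injective_iff_bijective.1 hb), fun j hj => ?_⟩
  have h1 := mem_Icc.1 (hm j hj)
  rw [mem_Icc] at hj
  rw [pval, dif_pos hj, Equiv.ofBijective_apply]
  simp only [Nat.sub_add_cancel hj.1]
  omega

theorem denr_eq {n : ℕ} (r : ℕ) (π : Equiv.Perm (Fin n)) :
    denr r π = ∑ q ∈ excpSet r π, q + invOn (excpSet r π) (pval π) +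
      invOn (Icc 1 n \ excpSet r π) (pval π) := by
  rw [denr, excWord, nexcWord, winv_map_sort, winv_map_sort]

theorem excpSet_eq {N r : ℕ} (hr : 1 ≤ r) (hrN : r ≤ N) (π : Equiv.Perm (Fin N)) :
    excpSet r π = lowExc r (pval π) ∪ highExc N r (pval π) := by
  ext q
  rw [excpSet, mem_filter, mem_union, mem_lowExc, mem_highExc, mem_Icc]
  omega

theorem excr_eq {N r : ℕ} (hr : 1 ≤ r) (π : Equiv.Perm (Fin N)) :
    excr r π = (highExc N r (pval π)).card := by
  rw [excr]
  congr 1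
  ext q
  rw [mem_filter, mem_highExc, mem_Icc]
  omega

section perm

variable {N r i : ℕ} {π : Equiv.Perm (Fin N)} {τ : Equiv.Perm (Fin (N + 1))}

theorem excpSet_beta (hr : 1 ≤ r) (hrN : r ≤ N) (hi : i ∈ Ico 1 r \ lowExc r (pval π))
    (hτ : ∀ q ∈ Icc 1 (N + 1), pval τ q = betaWord N r (pval π) i q) :
    excpSet r τ = betaExc N r (pval π) i := by
  have hX : ∀ q ∈ Icc 1 (N + 1), _ := fun q hq =>
    mem_betaExc_iff hr hrN (fun _ => pval_mem π) (pval_injOn π) hi hq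
  ext q
  rw [excpSet, mem_filter]
  constructor
  · rintro ⟨hq, h1⟩
    rwa [hτ q hq, ← hX q hq] at h1
  · intro h1
    have hq := betaExc_subset hrN hi h1
    exact ⟨hq, by rwa [hτ q hq, ← hX q hq]⟩

theorem excr_beta (hr : 1 ≤ r) (hrN : r ≤ N) (hi : i ∈ Ico 1 r \ lowExc r (pval π))
    (hτ : ∀ q ∈ Icc 1 (N + 1), pval τ q = betaWord N r (pval π) i q) :
    excr r τ = excr r π := by
  rw [excr_eq hr π, ← card_highExc_image, ← filter_le_betaExc hi, ← excpSet_beta hr hrN hi hτ, excr]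
  congr 1
  ext q
  rw [excpSet, mem_filter, mem_filter, mem_filter]
  exact ⟨fun h => ⟨⟨h.1, h.2.2, by omega⟩, h.2.1⟩, fun h => ⟨h.1.1, h.2, h.1.2.1⟩⟩

theorem denr_beta (hr : 1 ≤ r) (hrN : r ≤ N) (hi : i ∈ Ico 1 r \ lowExc r (pval π))
    (hτ : ∀ q ∈ Icc 1 (N + 1), pval τ q = betaWord N r (pval π) i q) :
    denr r τ = denr r π + ((highExc N r (pval π)).card + i +
      ((lowExc r (pval π)).filter (i < ·)).card) := by
  rw [denr_eq, denr_eq, excpSet_beta hr hrN hi hτ, excpSet_eq hr hrN π, sum_betaExc hi,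
    invOn_congr fun q hq => hτ q (betaExc_subset hrN hi hq),
    invOn_congr fun q hq => hτ q (mem_sdiff.1 hq).1,
    invOn_betaExc hr hrN (fun _ => pval_mem π) (pval_injOn π) hi,
    invOn_compl_betaExc hr hrN (fun _ => pval_mem π) (pval_injOn π) hi]
  omega

theorem beta_mem_diff (hr : 1 ≤ r) (hrN : r ≤ N) (hi : i ∈ Ico 1 r \ lowExc r (pval π))
    (hτ : ∀ q ∈ Icc 1 (N + 1), pval τ q = betaWord N r (pval π) i q) :
    τ ∈ Snr (N + 1) r \ SnrStar (N + 1) r := by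
  have hm : ∀ j ∈ Icc 1 N, pval π j ∈ Icc 1 N := fun _ => pval_mem π
  have hinj := pval_injOn π
  constructor
  · rintro ⟨q, hrq, hq1, hq2, hg⟩
    have hq : q ∈ Icc 1 (N + 1) := mem_Icc.2 ⟨hq1, hq2⟩
    rw [hτ q hq] at hg
    rcases betaWord_cases hr hrN hm hinj hi hq with h1 | h1 | h1
    · omega
    · obtain ⟨_, _, _, hv, _, h2, h3, h4, _⟩ := h1
      rcases hg with hg | ⟨_, hg⟩
      · omega
      obtain ⟨k, hk, hkv⟩ := exists_betaWord_eq hr hrN hm hinj hi hv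
      have hk' := betaExc_subset hrN hi hk
      have hk2 := (mem_betaExc_iff hr hrN hm hinj hi hk').1 hk
      rw [mem_Icc] at hk'
      refine hg k hk'.1 hk'.2 ?_ ?_ <;> rw [hτ k (mem_Icc.2 hk')] <;> omega
    · have h2 := h1.2.2.2.2
      omega
  · rintro ⟨_, h1⟩
    have hq : r ∈ Icc 1 (N + 1) := mem_Icc.2 ⟨hr, by omega⟩
    change r < pval τ r at h1
    rw [hτ r hq] at h1
    rcases betaWord_cases hr hrN hm hinj hi hq with h2 | h2 | h2 <;> omega

theorem exists_beta (hr : 1 ≤ r) (hrN : r ≤ N) (p : Equiv.Perm (Fin N) × ℕ)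
    (hp : p ∈ Ynr (N + 1) r) :
    ∃ τ : Equiv.Perm (Fin (N + 1)), ∃ i ∈ Ico 1 r \ lowExc r (pval p.1),
      (highExc N r (pval p.1)).card + i + ((lowExc r (pval p.1)).filter (i < ·)).card = p.2 ∧
      ∀ q ∈ Icc 1 (N + 1), pval τ q = betaWord N r (pval p.1) i q := by
  have hp' : (excpSet r p.1).card < p.2 ∧ p.2 ≤ excr r p.1 + r - 1 := hp
  rw [excpSet_eq hr hrN, excr_eq hr] at hp'
  obtain ⟨i, hi, hc⟩ := exists_place hp'.1 hp'.2
  obtain ⟨τ, hτ⟩ := exists_perm_pval_eq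
    (fun _ => betaWord_mapsTo hr hrN (fun _ => pval_mem p.1) hi)
    (betaWord_injOn hr hrN (fun _ => pval_mem p.1) (pval_injOn p.1) hi)
  exact ⟨τ, i, hi, hc, hτ⟩

end perm

/-- For 1 ≤ r < n there is an injection β from Y_{n,r} into
S_{n,r} ∖ S*_{n,r} with exc_r(β(π,c)) = exc_r(π) and
den_r(β(π,c)) = den_r(π) + c. -/
theorem exists_injection_beta (n r : ℕ) (hr : 1 ≤ r) (hrn : r < n) :
    ∃ β : Equiv.Perm (Fin (n - 1)) × ℕ → Equiv.Perm (Fin n),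
      Set.InjOn β (Ynr n r) ∧
      Set.MapsTo β (Ynr n r) (Snr n r \ SnrStar n r) ∧
      ∀ p ∈ Ynr n r,
        excr r (β p) = excr r p.1 ∧ denr r (β p) = denr r p.1 + p.2 := by
  obtain ⟨N, rfl⟩ : ∃ N, n = N + 1 := ⟨n - 1, by omega⟩
  have hrN : r ≤ N := Nat.le_of_lt_succ hrn
  have hex : ∀ p : Equiv.Perm (Fin N) × ℕ, ∃ τ : Equiv.Perm (Fin (N + 1)), p ∈ Ynr (N + 1) r →
      ∃ i ∈ Ico 1 r \ lowExc r (pval p.1),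
        (highExc N r (pval p.1)).card + i + ((lowExc r (pval p.1)).filter (i < ·)).card = p.2 ∧
        ∀ q ∈ Icc 1 (N + 1), pval τ q = betaWord N r (pval p.1) i q := by
    intro p
    by_cases hp : p ∈ Ynr (N + 1) r
    · obtain ⟨τ, hτ⟩ := exists_beta hr hrN p hp
      exact ⟨τ, fun _ => hτ⟩
    · exact ⟨1, fun h => absurd h hp⟩
  choose β hβ using hex
  have hden : ∀ p ∈ Ynr (N + 1) r, denr r (β p) = denr r p.1 + p.2 := by
    intro p hp
    obtain ⟨i, hi, hc, hτ⟩ := hβ p hp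
    rw [denr_beta hr hrN hi hτ, hc]
  refine ⟨β, ?_, ?_, ?_⟩
  · intro p hp p' hp' he
    have h1 := hden p hp
    have h2 := hden p' hp'
    obtain ⟨i, hi, _, hτ⟩ := hβ p hp
    obtain ⟨i', hi', _, hτ'⟩ := hβ p' hp'
    have hπ : p.1 = p'.1 := perm_ext_pval <|
      betaWord_injective hr hrN (fun _ => pval_mem p.1) (fun _ => pval_mem p'.1)
        (pval_injOn p.1) (pval_injOn p'.1) hi hi' fun q hq =>
          (hτ q hq).symm.trans ((congrArg (pval · q) he).trans (hτ' q hq))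
    rw [he, h2, hπ] at h1
    exact Prod.ext hπ (by omega)
  · intro p hp
    obtain ⟨i, hi, _, hτ⟩ := hβ p hp
    exact beta_mem_diff hr hrN hi hτ
  · intro p hp
    obtain ⟨i, hi, _, hτ⟩ := hβ p hp
    exact ⟨excr_beta hr hrN hi hτ, hden p hp⟩
end

section
/- For every positive integer n and every positive integer r, the statistic den_r is Mahonian on S_n: ∑_{π∈S_n} q^{den_r(π)} = [n]_q [n-1]_q ⋯ [1]_q, where [k]_q = 1 + q + q² + ⋯ + q^{k-1}. Equivalently, for every nonnegative integer m, the number of π ∈ S_n with den_r(π) = m equals the number of π ∈ S_n with inv(π) = m. -/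
open Finset

/-- The `r`-level Denert statistic with `r = s + 1`, in terms of `σ = π⁻¹` and 0-based indexing. -/
def denInv {n : ℕ} (s : ℕ) (σ : Equiv.Perm (Fin n)) : ℕ :=
  (∑ v, if σ v < v ∧ s ≤ v.val then (σ v).val + 1 else 0) +
  (univ.filter (fun p : Fin n × Fin n => p.1 < p.2 ∧ σ p.2 < σ p.1 ∧
    ((σ p.1 < p.1 ∧ s ≤ p.1.val) ↔ (σ p.2 < p.2 ∧ s ≤ p.2.val)))).card

theorem winv_map_sort_s11 (s : Finset ℕ) (f : ℕ → ℕ) :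
    winv ((s.sort (· ≤ ·)).map f) =
      ((s ×ˢ s).filter (fun p => p.1 < p.2 ∧ f p.2 < f p.1)).card := by
  set l := s.sort (· ≤ ·) with hl
  have hmem : ∀ x, x ∈ l ↔ x ∈ s := fun x => by simp [hl]
  have hlt : ∀ (a b : ℕ) (ha : a < l.length) (hb : b < l.length), l[a] < l[b] ↔ a < b := by
    intro a b ha hb
    have hs : l.SortedLT := s.sortedLT_sort
    exact hs.strictMono_get.lt_iff_lt (a := (⟨a, ha⟩ : Fin _)) (b := ⟨b, hb⟩)
  unfold winv
  refine Finset.card_bij (fun p _ => (l.getD p.1 0, l.getD p.2 0)) ?_ ?_ ?_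
  · rintro ⟨a, b⟩ h
    simp only [mem_filter, mem_product, mem_range, List.length_map] at h
    obtain ⟨⟨ha, hb⟩, hab, hf⟩ := h
    have h1 := (hlt a b ha hb).2 hab
    simp only [List.getD_eq_getElem?_getD, List.getElem?_map, ha, hb, List.getElem?_eq_getElem,
      Option.map_some, Option.getD_some] at hf ⊢
    simp [← hmem, h1, hf]
  · rintro ⟨a, b⟩ h ⟨c, d⟩ h' heq
    simp only [mem_filter, mem_product, mem_range, List.length_map] at h h'
    obtain ⟨⟨ha, hb⟩, -⟩ := h
    obtain ⟨⟨hc, hd⟩, -⟩ := h'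
    simp only [List.getD_eq_getElem?_getD, ha, hb, hc, hd, List.getElem?_eq_getElem,
      Option.getD_some, Prod.mk.injEq] at heq
    have e1 := hlt a c ha hc
    have e2 := hlt c a hc ha
    have e3 := hlt b d hb hd
    have e4 := hlt d b hd hb
    ext <;> simp <;> omega
  · rintro ⟨x, y⟩ h
    simp only [mem_filter, mem_product, ← hmem] at h
    obtain ⟨⟨hx, hy⟩, hxy, hf⟩ := h
    obtain ⟨a, ha, rfl⟩ := List.getElem_of_mem hx
    obtain ⟨b, hb, rfl⟩ := List.getElem_of_mem hy
    have h1 := (hlt a b ha hb).1 hxy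
    exact ⟨(a, b), by simp [ha, hb, h1, hf], by simp [ha, hb]⟩

theorem pval_succ {n : ℕ} (π : Equiv.Perm (Fin n)) (i : Fin n) :
    pval π (i.val + 1) = (π i).val + 1 := by
  have := i.2
  rw [pval, dif_pos (by omega)]
  rfl

theorem card_filter_pairs_eq {n : ℕ} (π : Equiv.Perm (Fin n)) (P : ℕ → ℕ → Prop)
    [∀ a b, Decidable (P a b)] :
    ((Icc 1 n ×ˢ Icc 1 n).filter (fun p : ℕ × ℕ => P p.1 p.2)).card =
      (univ.filter (fun p : Fin n × Fin n =>
        P ((π.symm p.2).val + 1) ((π.symm p.1).val + 1))).card := by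
  symm
  refine Finset.card_bij (fun p _ => ((π.symm p.2).val + 1, (π.symm p.1).val + 1)) ?_ ?_ ?_
  · rintro ⟨u, v⟩ h
    have hu := (π.symm u).2
    have hv := (π.symm v).2
    simp only [mem_filter, mem_univ, true_and] at h
    simp only [mem_filter, mem_product, mem_Icc]
    exact ⟨⟨⟨by omega, by omega⟩, by omega, by omega⟩, h⟩
  · rintro ⟨u, v⟩ _ ⟨u', v'⟩ _ h
    simpa [Fin.val_inj, and_comm] using h
  · rintro ⟨a, b⟩ h
    simp only [mem_filter, mem_product, mem_Icc] at h
    obtain ⟨⟨⟨ha, ha'⟩, hb, hb'⟩, hP⟩ := h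
    refine ⟨(π ⟨b - 1, by omega⟩, π ⟨a - 1, by omega⟩), ?_, ?_⟩
    · simpa [Nat.sub_add_cancel ha, Nat.sub_add_cancel hb] using hP
    · simp [Nat.sub_add_cancel ha, Nat.sub_add_cancel hb]

theorem sum_Icc_eq_sum_symm {n : ℕ} (π : Equiv.Perm (Fin n)) (f : ℕ → ℕ) :
    ∑ i ∈ Icc 1 n, f i = ∑ v, f ((π.symm v).val + 1) := by
  rw [Equiv.sum_comp π.symm (fun i : Fin n => f (i.val + 1)),
    Fin.sum_univ_eq_sum_range (fun i => f (i + 1)) n, Finset.range_eq_Ico,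
    Finset.sum_Ico_add' f 0 n 1]
  rfl

theorem denr_succ_eq_denInv {n : ℕ} (s : ℕ) (π : Equiv.Perm (Fin n)) :
    denr (s + 1) π = denInv s π⁻¹ := by
  have hpv (v : Fin n) : pval π ((π.symm v).val + 1) = v.val + 1 := by simp [pval_succ]
  have hsplit : winv (excWord (s + 1) π) + winv (nexcWord (s + 1) π) =
      ((Icc 1 n ×ˢ Icc 1 n).filter (fun p : ℕ × ℕ => p.1 < p.2 ∧ pval π p.2 < pval π p.1 ∧
        ((p.1 < pval π p.1 ∧ s + 1 ≤ pval π p.1) ↔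
          (p.2 < pval π p.2 ∧ s + 1 ≤ pval π p.2)))).card := by
    rw [excWord, nexcWord, winv_map_sort_s11, winv_map_sort_s11, ← Finset.card_union_of_disjoint]
    · congr 1
      ext ⟨a, b⟩
      simp only [excpSet, mem_union, mem_filter, mem_product, mem_sdiff]
      tauto
    · rw [Finset.disjoint_left]
      rintro ⟨a, b⟩ h h'
      simp only [mem_filter, mem_product, mem_sdiff] at h h'
      tauto
  rw [denr, add_assoc, hsplit, card_filter_pairs_eq π (fun a b => a < b ∧ pval π b < pval π a ∧
        ((a < pval π a ∧ s + 1 ≤ pval π a) ↔ (b < pval π b ∧ s + 1 ≤ pval π b))),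
    excpSet, Finset.sum_filter,
    sum_Icc_eq_sum_symm π (fun i => if i < pval π i ∧ s + 1 ≤ pval π i then i else 0), denInv]
  simp only [hpv, Equiv.Perm.inv_def, Fin.lt_def, add_lt_add_iff_right, add_le_add_iff_right]
  congr 2
  ext p
  simp only [mem_filter]
  tauto

theorem invStat_eq_denInv {n s : ℕ} (hs : n ≤ s) (π : Equiv.Perm (Fin n)) :
    invStat π = denInv s π⁻¹ := by
  have hpv (v : Fin n) : pval π ((π.symm v).val + 1) = v.val + 1 := by simp [pval_succ]
  have hlt (v : Fin n) : ¬ s ≤ v.val := by omega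
  rw [invStat, card_filter_pairs_eq π (fun a b => a < b ∧ pval π b < pval π a), denInv]
  simp only [hpv, hlt, and_false, if_false, Finset.sum_const_zero, zero_add, iff_self, and_true,
    Equiv.Perm.inv_def, Fin.lt_def, add_lt_add_iff_right]
  congr 2
  ext p
  tauto

theorem denInv_succ_of_le {n s : ℕ} {σ : Equiv.Perm (Fin n)}
    (h : ∀ v : Fin n, v.val = s → s ≤ (σ v).val) : denInv (s + 1) σ = denInv s σ := by
  have key (v : Fin n) : (σ v < v ∧ s + 1 ≤ v.val) ↔ (σ v < v ∧ s ≤ v.val) := by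
    have := h v
    rw [Fin.lt_def]
    omega
  simp only [denInv, key]

theorem denInv_add_eq {n : ℕ} {σ : Equiv.Perm (Fin n)} {x : Fin n} (hx : σ x < x) :
    denInv x.val σ + x.val = denInv (x.val + 1) σ + 2 * (σ x).val + 1 := by
  have key (v : Fin n) (hv : v ≠ x) :
      (σ v < v ∧ x.val + 1 ≤ v.val) ↔ (σ v < v ∧ x.val ≤ v.val) := by
    have : v.val ≠ x.val := fun h => hv (Fin.ext h)
    omega
  have hsum : (∑ v, if σ v < v ∧ x.val ≤ v.val then (σ v).val + 1 else 0) =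
      (∑ v, if σ v < v ∧ x.val + 1 ≤ v.val then (σ v).val + 1 else 0) + ((σ x).val + 1) := by
    rw [← Finset.sum_erase_add _ _ (mem_univ x), ← Finset.sum_erase_add univ
      (fun v => if σ v < v ∧ x.val + 1 ≤ v.val then (σ v).val + 1 else 0) (mem_univ x)]
    have : ∀ v ∈ univ.erase x, (if σ v < v ∧ x.val ≤ v.val then (σ v).val + 1 else 0) =
        (if σ v < v ∧ x.val + 1 ≤ v.val then (σ v).val + 1 else 0) := by
      intro v hv
      simp only [key v (Finset.ne_of_mem_erase hv)]
    rw [Finset.sum_congr rfl this]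
    simp [hx]
  have hA : (univ.filter (fun p : Fin n × Fin n => (p.1 < p.2 ∧ σ p.2 < σ p.1 ∧
      ((σ p.1 < p.1 ∧ x.val ≤ p.1.val) ↔ (σ p.2 < p.2 ∧ x.val ≤ p.2.val))) ∧
      (p.1 = x ∨ p.2 = x))).card =
      (univ.filter (fun v : Fin n => x < v ∧ σ v < σ x)).card := by
    symm
    refine Finset.card_bij (fun v _ => (x, v)) ?_ ?_ ?_
    · intro v hv
      simp only [mem_filter, mem_univ, true_and] at hv ⊢
      exact ⟨⟨hv.1, hv.2, by omega⟩, Or.inl trivial⟩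
    · intro v _ w _ h
      simpa using h
    · rintro ⟨u, v⟩ h
      simp only [mem_filter, mem_univ, true_and] at h
      obtain ⟨⟨h1, h2, h3⟩, rfl | rfl⟩ := h
      · exact ⟨v, by simp [h1, h2], rfl⟩
      · omega
  have hB : (univ.filter (fun p : Fin n × Fin n => (p.1 < p.2 ∧ σ p.2 < σ p.1 ∧
      ((σ p.1 < p.1 ∧ x.val + 1 ≤ p.1.val) ↔ (σ p.2 < p.2 ∧ x.val + 1 ≤ p.2.val))) ∧
      (p.1 = x ∨ p.2 = x))).card =
      (univ.filter (fun v : Fin n => v < x ∧ σ x < σ v)).card := by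
    symm
    refine Finset.card_bij (fun v _ => (v, x)) ?_ ?_ ?_
    · intro v hv
      simp only [mem_filter, mem_univ, true_and] at hv ⊢
      exact ⟨⟨hv.1, hv.2, by omega⟩, Or.inr trivial⟩
    · intro v _ w _ h
      simpa using h
    · rintro ⟨u, v⟩ h
      simp only [mem_filter, mem_univ, true_and] at h
      obtain ⟨⟨h1, h2, h3⟩, rfl | rfl⟩ := h
      · omega
      · exact ⟨u, by simp [h1, h2], rfl⟩
  have hP : (univ.filter (fun p : Fin n × Fin n => (p.1 < p.2 ∧ σ p.2 < σ p.1 ∧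
      ((σ p.1 < p.1 ∧ x.val ≤ p.1.val) ↔ (σ p.2 < p.2 ∧ x.val ≤ p.2.val))) ∧
      ¬ (p.1 = x ∨ p.2 = x))) =
      (univ.filter (fun p : Fin n × Fin n => (p.1 < p.2 ∧ σ p.2 < σ p.1 ∧
      ((σ p.1 < p.1 ∧ x.val + 1 ≤ p.1.val) ↔ (σ p.2 < p.2 ∧ x.val + 1 ≤ p.2.val))) ∧
      ¬ (p.1 = x ∨ p.2 = x))) := by
    refine Finset.filter_congr fun p _ => ?_
    refine and_congr_left fun h => ?_
    rw [not_or] at h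
    rw [key _ h.1, key _ h.2]
  have hAC : (univ.filter (fun v : Fin n => x < v ∧ σ v < σ x)).card +
      (univ.filter (fun v : Fin n => v < x ∧ σ v < σ x)).card = (σ x).val := by
    rw [← Fin.card_Iio (σ x), ← Finset.card_map σ.symm.toEmbedding (s := Iio (σ x)),
      ← Finset.card_union_of_disjoint]
    · congr 1
      ext v
      simp only [mem_union, mem_filter, mem_univ, true_and, mem_map_equiv, Equiv.symm_symm, mem_Iio]
      have : σ v < σ x → v ≠ x := by rintro h rfl; exact lt_irrefl _ h
      omega
    · rw [Finset.disjoint_left]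
      intro v h h'
      simp only [mem_filter] at h h'
      omega
  have hBC : (univ.filter (fun v : Fin n => v < x ∧ σ x < σ v)).card +
      (univ.filter (fun v : Fin n => v < x ∧ σ v < σ x)).card = x.val := by
    rw [← Fin.card_Iio x, ← Finset.card_union_of_disjoint]
    · congr 1
      ext v
      simp only [mem_union, mem_filter, mem_univ, true_and, mem_Iio]
      have : v < x → σ v ≠ σ x := fun h h' => h.ne (σ.injective h')
      omega
    · rw [Finset.disjoint_left]
      intro v h h'
      simp only [mem_filter] at h h'
      omega
  rw [denInv, denInv, hsum,
    ← Finset.card_filter_add_card_filter_not (p := fun p : Fin n × Fin n => p.1 = x ∨ p.2 = x),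
    ← Finset.card_filter_add_card_filter_not (s := univ.filter (fun p : Fin n × Fin n =>
      p.1 < p.2 ∧ σ p.2 < σ p.1 ∧ ((σ p.1 < p.1 ∧ x.val + 1 ≤ p.1.val) ↔
        (σ p.2 < p.2 ∧ x.val + 1 ≤ p.2.val)))) (p := fun p : Fin n × Fin n => p.1 = x ∨ p.2 = x)]
  simp only [Finset.filter_filter]
  rw [hA, hB, hP]
  omega

theorem denInv_swap_mul {n : ℕ} {σ : Equiv.Perm (Fin n)} {x i j : Fin n} (hi : σ x = i)
    (hij : j.val = i.val + 1) (hj : j < x) :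
    denInv (x.val + 1) σ = denInv (x.val + 1) (Equiv.swap i j * σ) + 1 := by
  set τ := Equiv.swap i j * σ with hτ
  obtain ⟨c, hc⟩ := σ.surjective j
  have hcx : c ≠ x := by
    rintro rfl
    have : i = j := hi.symm.trans hc
    rw [this] at hij
    omega
  have hτx : τ x = j := by simp [hτ, hi]
  have hτc : τ c = i := by simp [hτ, hc]
  have hne (v : Fin n) (hvx : v ≠ x) (hvc : v ≠ c) : τ v = σ v ∧ σ v ≠ i ∧ σ v ≠ j := by
    have h1 : σ v ≠ i := fun h => hvx (σ.injective (h.trans hi.symm))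
    have h2 : σ v ≠ j := fun h => hvc (σ.injective (h.trans hc.symm))
    exact ⟨by simp [hτ, Equiv.swap_apply_of_ne_of_ne h1 h2], h1, h2⟩
  have hE (v : Fin n) : (τ v < v ∧ x.val + 1 ≤ v.val) ↔ (σ v < v ∧ x.val + 1 ≤ v.val) := by
    by_cases hvx : v = x
    · subst hvx; omega
    by_cases hvc : v = c
    · subst hvc; rw [hτc, hc]; omega
    rw [(hne v hvx hvc).1]
  have hL (u v : Fin n) (h : ¬ ((u = x ∧ v = c) ∨ (u = c ∧ v = x))) : τ v < τ u ↔ σ v < σ u := by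
    by_cases hux : u = x
    · subst hux
      by_cases hvx : v = u
      · subst hvx; simp
      by_cases hvc : v = c
      · subst hvc; simp at h
      obtain ⟨h1, h2, h3⟩ := hne v hvx hvc
      rw [h1, hτx, hi]; omega
    by_cases huc : u = c
    · subst huc
      by_cases hvx : v = x
      · subst hvx; simp at h
      by_cases hvc : v = u
      · subst hvc; simp
      obtain ⟨h1, h2, h3⟩ := hne v hvx hvc
      rw [h1, hτc, hc]; omega
    obtain ⟨h1, h2, h3⟩ := hne u hux huc
    by_cases hvx : v = x
    · subst hvx; rw [h1, hτx, hi]; omega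
    by_cases hvc : v = c
    · subst hvc; rw [h1, hτc, hc]; omega
    rw [h1, (hne v hvx hvc).1]
  simp only [denInv, hE]
  rcases lt_or_gt_of_ne hcx with hlt | hgt
  · have hsum : (∑ v, if σ v < v ∧ x.val + 1 ≤ v.val then (σ v).val + 1 else 0) =
        (∑ v, if σ v < v ∧ x.val + 1 ≤ v.val then (τ v).val + 1 else 0) := by
      refine Finset.sum_congr rfl fun v _ => ?_
      split_ifs with h
      · rw [(hne v (by rintro rfl; omega) (by rintro rfl; omega)).1]
      · rfl
    rw [hsum, add_assoc]
    congr 1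
    rw [← Finset.card_insert_of_notMem (a := (c, x))]
    · congr 1
      ext ⟨u, v⟩
      simp only [mem_filter, mem_univ, true_and, mem_insert, Prod.mk.injEq]
      by_cases h : (u = x ∧ v = c) ∨ (u = c ∧ v = x)
      · rcases h with ⟨rfl, rfl⟩ | ⟨rfl, rfl⟩
        · omega
        · simp only [hi, hc, hlt, and_self, true_or, true_and, iff_true]
          omega
      · rw [hL u v h]
        have : ¬ (u = c ∧ v = x) := fun h' => h (Or.inr h')
        simp only [this, false_or]
    · simp only [mem_filter, hτx, hτc]
      omega
  · have hsum : (∑ v, if σ v < v ∧ x.val + 1 ≤ v.val then (σ v).val + 1 else 0) =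
        (∑ v, if σ v < v ∧ x.val + 1 ≤ v.val then (τ v).val + 1 else 0) + 1 := by
      rw [← Finset.sum_erase_add _ _ (mem_univ c), ← Finset.sum_erase_add univ
        (fun v => if σ v < v ∧ x.val + 1 ≤ v.val then (τ v).val + 1 else 0) (mem_univ c)]
      have : ∀ v ∈ univ.erase c, (if σ v < v ∧ x.val + 1 ≤ v.val then (σ v).val + 1 else 0) =
          (if σ v < v ∧ x.val + 1 ≤ v.val then (τ v).val + 1 else 0) := by
        intro v hv
        split_ifs with h
        · rw [(hne v (by rintro rfl; omega) (Finset.ne_of_mem_erase hv)).1]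
        · rfl
      have hcE : σ c < c ∧ x.val + 1 ≤ c.val := by rw [hc]; omega
      rw [Finset.sum_congr rfl this, if_pos hcE, if_pos hcE, hc, hτc]
      omega
    rw [hsum, add_right_comm]
    congr 3
    ext ⟨u, v⟩
    simp only [mem_filter, mem_univ, true_and]
    by_cases h : (u = x ∧ v = c) ∨ (u = c ∧ v = x)
    · rcases h with ⟨rfl, rfl⟩ | ⟨rfl, rfl⟩ <;> simp only [hi, hc] <;> omega
    · rw [hL u v h]

theorem exists_mul_denInv_of_le {n : ℕ} {x i : Fin n} (k : ℕ) (j : Fin n) (hij : j.val = i.val + k)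
    (hj : j < x) :
    ∃ τ : Equiv.Perm (Fin n), τ i = j ∧ ∀ σ : Equiv.Perm (Fin n), σ x = i →
      denInv (x.val + 1) σ = denInv (x.val + 1) (τ * σ) + k := by
  induction k generalizing j with
  | zero =>
    obtain rfl : i = j := Fin.ext hij.symm
    exact ⟨1, rfl, fun σ _ => by simp⟩
  | succ k ih =>
    let j' : Fin n := ⟨i.val + k, by omega⟩
    obtain ⟨τ, hτ, h⟩ := ih j' rfl (by simp only [j', Fin.lt_def]; omega)
    refine ⟨Equiv.swap j' j * τ, by simp [hτ], fun σ hσ => ?_⟩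
    rw [h σ hσ, denInv_swap_mul (σ := τ * σ) (i := j') (j := j) (by simp [hσ, hτ])
      (by simp only [j']; omega) hj, mul_assoc]
    omega

theorem exists_mul_denInv {n : ℕ} {x i j : Fin n} (hi : i < x) (hj : j < x) :
    ∃ τ : Equiv.Perm (Fin n), τ i = j ∧ ∀ σ : Equiv.Perm (Fin n), σ x = i →
      denInv (x.val + 1) σ + i.val = denInv (x.val + 1) (τ * σ) + j.val := by
  rcases le_total i.val j.val with h | h
  · obtain ⟨k, hk⟩ := Nat.exists_eq_add_of_le h
    obtain ⟨τ, hτ, H⟩ := exists_mul_denInv_of_le k j hk hj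
    refine ⟨τ, hτ, fun σ hσ => ?_⟩
    have := H σ hσ
    omega
  · obtain ⟨k, hk⟩ := Nat.exists_eq_add_of_le h
    obtain ⟨τ, hτ, H⟩ := exists_mul_denInv_of_le k i hk hi
    refine ⟨τ⁻¹, by simp [← hτ], fun σ hσ => ?_⟩
    have := H (τ⁻¹ * σ) (by simp [hσ, ← hτ])
    rw [mul_inv_cancel_left] at this
    omega

/-- Adjacent levels are equidistributed: reflect the position `i < s` of the letter `s`
to `s - 1 - i`. -/
theorem exists_equiv_denInv (n s : ℕ) :
    ∃ e : Equiv.Perm (Fin n) ≃ Equiv.Perm (Fin n), ∀ σ, denInv s (e σ) = denInv (s + 1) σ := by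
  by_cases hs : s < n
  swap
  · exact ⟨Equiv.refl _, fun σ => (denInv_succ_of_le fun v hv => by omega).symm⟩
  obtain ⟨x, rfl⟩ : ∃ x : Fin n, x.val = s := ⟨⟨s, hs⟩, rfl⟩
  have hex (i : Fin n) : ∃ τ : Equiv.Perm (Fin n),
      (i < x → (τ i).val = x.val - 1 - i.val ∧ ∀ σ : Equiv.Perm (Fin n), σ x = i →
        denInv (x.val + 1) σ + i.val = denInv (x.val + 1) (τ * σ) + (x.val - 1 - i.val)) ∧
      (¬ i < x → τ = 1) := by
    by_cases hi : i < x
    · have hi' : i.val < x.val := hi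
      obtain ⟨τ, hτ, H⟩ := exists_mul_denInv (j := ⟨x.val - 1 - i.val, by omega⟩) hi
        (by simp only [Fin.lt_def]; omega)
      exact ⟨τ, fun _ => ⟨by rw [hτ], H⟩, fun h => absurd hi h⟩
    · exact ⟨1, fun h => absurd h hi, fun _ => rfl⟩
  choose τ hlt hge using hex
  have hinj : Function.Injective fun σ : Equiv.Perm (Fin n) => τ (σ x) * σ := by
    intro σ ρ h
    have h : τ (σ x) * σ = τ (ρ x) * ρ := h
    have hx : τ (σ x) (σ x) = τ (ρ x) (ρ x) := congrArg (fun f : Equiv.Perm (Fin n) => f x) h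
    have hxv := congrArg Fin.val hx
    have key : σ x = ρ x := by
      by_cases h1 : σ x < x <;> by_cases h2 : ρ x < x
      · have e1 := (hlt _ h1).1
        have e2 := (hlt _ h2).1
        simp only [Fin.lt_def] at h1 h2 e1 e2 hxv
        exact Fin.ext (by omega)
      · have e1 := (hlt _ h1).1
        simp only [hge _ h2, Equiv.Perm.one_apply] at hxv
        simp only [Fin.lt_def] at h1 h2 e1 hxv
        omega
      · have e2 := (hlt _ h2).1
        simp only [hge _ h1, Equiv.Perm.one_apply] at hxv
        simp only [Fin.lt_def] at h1 h2 e2 hxv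
        omega
      · simpa [hge _ h1, hge _ h2] using hx
    rw [key] at h
    exact mul_left_cancel h
  refine ⟨Equiv.ofBijective _ (Finite.injective_iff_bijective.1 hinj), fun σ => ?_⟩
  change denInv x.val (τ (σ x) * σ) = _
  by_cases h : σ x < x
  · obtain ⟨h1, h2⟩ := hlt _ h
    have h3 := h2 σ rfl
    have hs' : (σ x).val < x.val := h
    have hmul : (τ (σ x) * σ) x = τ (σ x) (σ x) := rfl
    have h4 := denInv_add_eq (σ := τ (σ x) * σ) (x := x)
      (by rw [hmul, Fin.lt_def, h1]; omega)
    rw [hmul, h1] at h4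
    omega
  · rw [hge _ h, one_mul]
    refine (denInv_succ_of_le fun v hv => ?_).symm
    obtain rfl : v = x := Fin.ext hv
    exact Fin.not_lt.1 h

theorem exists_equiv_denInv_add (n s k : ℕ) :
    ∃ e : Equiv.Perm (Fin n) ≃ Equiv.Perm (Fin n), ∀ σ, denInv s (e σ) = denInv (s + k) σ := by
  induction k with
  | zero => exact ⟨Equiv.refl _, fun _ => rfl⟩
  | succ k ih =>
    obtain ⟨e, he⟩ := ih
    obtain ⟨f, hf⟩ := exists_equiv_denInv n (s + k)
    exact ⟨f.trans e, fun σ => (he _).trans (hf σ)⟩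

/-- For n ≥ 1 and r ≥ 1 the statistic den_r is Mahonian on S_n:
for every m, the number of π ∈ S_n with den_r(π) = m equals the number of
π ∈ S_n with inv(π) = m. -/
theorem denr_mahonian (n r : ℕ) (hn : 1 ≤ n) (hr : 1 ≤ r) (m : ℕ) :
    (Finset.univ.filter (fun π : Equiv.Perm (Fin n) => denr r π = m)).card =
    (Finset.univ.filter (fun π : Equiv.Perm (Fin n) => invStat π = m)).card := by
  obtain ⟨s, rfl⟩ := Nat.exists_eq_add_of_le' hr
  obtain ⟨e, he⟩ := exists_equiv_denInv_add n s n
  symm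
  refine Finset.card_equiv (((Equiv.inv _).trans e).trans (Equiv.inv _)) fun π => ?_
  simp [denr_succ_eq_denInv, invStat_eq_denInv (Nat.le_add_left n s), he]
end
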